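/- Let u be a nonnegative smooth solution of the heat equation Δu = ∂_t u on ℝⁿ × (-∞, 0]. Then there exist a nonnegative Borel measure ρ on [0,∞) and a jointly measurable function h : [0,∞) × ℝⁿ → [0,∞) such that for ρ-almost every s the function h(s,·) is smooth and satisfies the elliptic equation Δ_x h(s,x) = s · h(s,x) on ℝⁿ, and u(x,t) = ∫₀^∞ e^{t s} h(s,x) dρ(s) for all x ∈ ℝⁿ and t ≤ 0. -/

import Mathlib

open MeasureTheory Real

noncomputable section

/-- Spatial Laplacian of `f : ℝⁿ → ℝ` at `x` (sum of second partial derivatives). -/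
def lap (n : ℕ) (f : EuclideanSpace ℝ (Fin n) → ℝ) (x : EuclideanSpace ℝ (Fin n)) : ℝ :=
  ∑ i : Fin n, fderiv ℝ (fun y => fderiv ℝ f y (EuclideanSpace.single i 1)) x
    (EuclideanSpace.single i 1)

/-- `u` is a smooth ancient solution of the heat equation on `ℝⁿ × (-∞, 0]`:
it is smooth and satisfies `Δ_x u = ∂_t u` for all `t ≤ 0`. -/
def IsAncientHeat (n : ℕ) (u : EuclideanSpace ℝ (Fin n) × ℝ → ℝ) : Prop :=
  ContDiff ℝ (⊤ : ℕ∞) u ∧ ∀ (x : EuclideanSpace ℝ (Fin n)) (t : ℝ), t ≤ 0 →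
    lap n (fun y => u (y, t)) x = deriv (fun s => u (x, s)) t

section HeatRepresentation

open Filter Topology Set ProbabilityTheory

section ExponentialIntegral

variable {V F : Type} [NormedAddCommGroup V] [InnerProductSpace ℝ V] [FiniteDimensional ℝ V]
  [MeasurableSpace V] [NormedAddCommGroup F]

theorem exists_norm_le_of_continuous_of_ae_norm_le {κ : Measure V} {r : ℝ}
    (hκ : ∀ᵐ ξ ∂κ, ‖ξ‖ ≤ r) {g : V → F} (hg : Continuous g) :
    ∃ C, 0 ≤ C ∧ ∀ᵐ ξ ∂κ, ‖g ξ‖ ≤ C := by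
  obtain ⟨C, hC⟩ := (isCompact_closedBall (0 : V) r).exists_bound_of_continuousOn hg.continuousOn
  refine ⟨max C 0, le_max_right _ _, ?_⟩
  filter_upwards [hκ] with ξ hξ
  exact (hC ξ (by simpa using hξ)).trans (le_max_left _ _)

variable [BorelSpace V]

theorem integrable_of_continuous_of_ae_norm_le {κ : Measure V} [IsFiniteMeasure κ] {r : ℝ}
    (hκ : ∀ᵐ ξ ∂κ, ‖ξ‖ ≤ r) {g : V → F} (hg : Continuous g) : Integrable g κ := by
  obtain ⟨C, -, hC⟩ := exists_norm_le_of_continuous_of_ae_norm_le hκ hg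
  exact Integrable.of_bound hg.aestronglyMeasurable C hC

variable [NormedSpace ℝ F]

theorem hasFDerivAt_integral_exp_inner_smul {κ : Measure V} [IsFiniteMeasure κ] {r : ℝ}
    (hκ : ∀ᵐ ξ ∂κ, ‖ξ‖ ≤ r) {g : V → F} (hg : Continuous g) (x : V) :
    HasFDerivAt (fun x => ∫ ξ, exp (inner ℝ x ξ) • g ξ ∂κ)
      (∫ ξ, exp (inner ℝ x ξ) • (innerSL ℝ ξ).smulRight (g ξ) ∂κ) x := by
  have hG : Continuous fun ξ : V => (innerSL ℝ ξ).smulRight (g ξ) := by fun_prop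
  obtain ⟨C, hC0, hC⟩ := exists_norm_le_of_continuous_of_ae_norm_le hκ hG
  have hexp : ∀ y : V, Continuous fun ξ : V => exp (inner ℝ y ξ) := fun y => by fun_prop
  refine hasFDerivAt_integral_of_dominated_of_fderiv_le (μ := κ) (𝕜 := ℝ)
    (F := fun x ξ => exp (inner ℝ x ξ) • g ξ)
    (F' := fun x ξ => exp (inner ℝ x ξ) • (innerSL ℝ ξ).smulRight (g ξ))
    (Metric.ball_mem_nhds x one_pos)
    (bound := fun _ => exp ((‖x‖ + 1) * r) * C) ?_ ?_ ?_ ?_ (integrable_const _) ?_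
  · exact Eventually.of_forall fun y => ((hexp y).smul hg).aestronglyMeasurable
  · exact integrable_of_continuous_of_ae_norm_le hκ ((hexp x).smul hg)
  · exact ((hexp x).smul hG).aestronglyMeasurable
  · filter_upwards [hC, hκ] with ξ h1 h2 y hy
    rw [norm_smul, Real.norm_of_nonneg (exp_pos _).le]
    have hy' : ‖y‖ ≤ ‖x‖ + 1 := by
      have h3 := norm_le_norm_add_norm_sub' y x
      have h4 : ‖y - x‖ < 1 := by simpa [dist_eq_norm] using hy
      linarith
    gcongr
    exact (real_inner_le_norm y ξ).trans (by gcongr)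
  · refine Eventually.of_forall fun ξ y _ => ?_
    have h1 : HasFDerivAt (fun y : V => inner ℝ y ξ) (innerSL ℝ ξ) y := by
      have := (innerSL ℝ ξ).hasFDerivAt (x := y)
      refine this.congr_of_eventuallyEq (Eventually.of_forall fun z => ?_)
      simp [real_inner_comm]
    convert h1.exp.smul_const (g ξ) using 1
    ext v
    simp [smul_smul]

theorem contDiff_integral_exp_inner_smul {κ : Measure V} [IsFiniteMeasure κ] {r : ℝ}
    (hκ : ∀ᵐ ξ ∂κ, ‖ξ‖ ≤ r) (m : ℕ) {F : Type} [NormedAddCommGroup F] [NormedSpace ℝ F]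
    {g : V → F} (hg : Continuous g) :
    ContDiff ℝ m (fun x => ∫ ξ, exp (inner ℝ x ξ) • g ξ ∂κ) := by
  induction m generalizing F with
  | zero =>
    exact contDiff_zero.2 (continuous_iff_continuousAt.2 fun x =>
      (hasFDerivAt_integral_exp_inner_smul hκ hg x).continuousAt)
  | succ m ih =>
    have hd := hasFDerivAt_integral_exp_inner_smul hκ hg
    push_cast
    rw [contDiff_succ_iff_fderiv]
    refine ⟨fun x => (hd x).differentiableAt, by simp, ?_⟩
    rw [show fderiv ℝ (fun x => ∫ ξ, exp (inner ℝ x ξ) • g ξ ∂κ) = _ from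
      funext fun x => (hd x).fderiv]
    exact ih (by fun_prop)

theorem fderiv_integral_exp_inner_mul_apply {κ : Measure V} [IsFiniteMeasure κ] {r : ℝ}
    (hκ : ∀ᵐ ξ ∂κ, ‖ξ‖ ≤ r) {g : V → ℝ} (hg : Continuous g) (x v : V) :
    fderiv ℝ (fun x => ∫ ξ, exp (inner ℝ x ξ) * g ξ ∂κ) x v =
      ∫ ξ, exp (inner ℝ x ξ) * (inner ℝ ξ v * g ξ) ∂κ := by
  have := (hasFDerivAt_integral_exp_inner_smul hκ hg x).fderiv
  simp only [smul_eq_mul] at this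
  rw [this, ContinuousLinearMap.integral_apply]
  · simp
  · exact integrable_of_continuous_of_ae_norm_le hκ (by fun_prop)

end ExponentialIntegral

theorem lap_integral_exp_inner {n : ℕ} {κ : Measure (EuclideanSpace ℝ (Fin n))}
    [IsFiniteMeasure κ] {s : ℝ} (hκ : ∀ᵐ ξ ∂κ, ‖ξ‖ ^ 2 = s) (x : EuclideanSpace ℝ (Fin n)) :
    lap n (fun x => ∫ ξ, exp (inner ℝ x ξ) ∂κ) x = s * ∫ ξ, exp (inner ℝ x ξ) ∂κ := by
  have hr : ∀ᵐ ξ ∂κ, ‖ξ‖ ≤ √s := by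
    filter_upwards [hκ] with ξ hξ
    rw [← hξ, Real.sqrt_sq (norm_nonneg ξ)]
  have h1 : ∀ (x v : EuclideanSpace ℝ (Fin n)),
      fderiv ℝ (fun x => ∫ ξ, exp (inner ℝ x ξ) ∂κ) x v =
        ∫ ξ, exp (inner ℝ x ξ) * inner ℝ ξ v ∂κ := fun x v => by
    simpa using fderiv_integral_exp_inner_mul_apply hr (g := fun _ => 1) continuous_const x v
  simp only [lap, h1]
  have h2 : ∀ v : EuclideanSpace ℝ (Fin n), Continuous fun ξ => (inner ℝ ξ v : ℝ) :=
    fun v => by fun_prop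
  simp only [fun v => fderiv_integral_exp_inner_mul_apply hr (h2 v) x v]
  rw [← integral_finsetSum, ← integral_const_mul]
  · refine integral_congr_ae ?_
    filter_upwards [hκ] with ξ hξ
    rw [← Finset.mul_sum, ← hξ, EuclideanSpace.norm_sq_eq, mul_comm]
    simp [EuclideanSpace.inner_single_right, sq]
  · exact fun i _ => integrable_of_continuous_of_ae_norm_le hr (by fun_prop)

theorem exists_elliptic_laplace_rep {n : ℕ} (ν : Measure (EuclideanSpace ℝ (Fin n)))
    [IsFiniteMeasure ν] :
    ∃ (ρ : Measure ℝ) (h : ℝ → EuclideanSpace ℝ (Fin n) → ℝ),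
      ρ (Iio 0) = 0 ∧ (∀ s x, 0 ≤ h s x) ∧ Measurable (Function.uncurry h) ∧
      (∀ s, ContDiff ℝ (⊤ : ℕ∞) (h s) ∧ ∀ x, lap n (h s) x = s * h s x) ∧
      ∀ (x : EuclideanSpace ℝ (Fin n)) (t : ℝ),
        Integrable (fun ξ => exp (inner ℝ x ξ + t * ‖ξ‖ ^ 2)) ν →
        ∫ ξ, exp (inner ℝ x ξ + t * ‖ξ‖ ^ 2) ∂ν = ∫ s, exp (t * s) * h s x ∂ρ := by
  set Φ : EuclideanSpace ℝ (Fin n) → ℝ × EuclideanSpace ℝ (Fin n) := fun ξ => (‖ξ‖ ^ 2, ξ)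
  have hΦ : Measurable Φ := by fun_prop
  set M := ν.map Φ
  have hM : M.fst ⊗ₘ M.condKernel = M := M.disintegrate M.condKernel
  set S : ℝ → Set (EuclideanSpace ℝ (Fin n)) := fun s => {ξ | ‖ξ‖ ^ 2 = s}
  have hS : ∀ s, MeasurableSet (S s) := fun s =>
    measurableSet_eq_fun (by fun_prop) measurable_const
  have hSS : MeasurableSet {p : ℝ × EuclideanSpace ℝ (Fin n) | ‖p.2‖ ^ 2 = p.1} :=
    measurableSet_eq_fun (by fun_prop) (by fun_prop)
  have hae : ∀ s, ∀ᵐ ξ ∂((M.condKernel s).restrict (S s)), ‖ξ‖ ^ 2 = s := fun s =>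
    ae_restrict_mem (hS s)
  refine ⟨M.fst, fun s x => ∫ ξ in S s, exp (inner ℝ x ξ) ∂(M.condKernel s), ?_, ?_, ?_, ?_, ?_⟩
  · rw [Measure.fst_apply measurableSet_Iio,
      Measure.map_apply hΦ (measurable_fst measurableSet_Iio)]
    convert measure_empty (μ := ν)
    ext ξ
    simp [Φ]
  · exact fun s x => integral_nonneg fun ξ => (exp_pos _).le
  · have h1 : (Function.uncurry fun s x => ∫ ξ in S s, exp (inner ℝ x ξ) ∂(M.condKernel s)) =
        fun p : ℝ × EuclideanSpace ℝ (Fin n) => ∫ ξ, (S p.1).indicator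
          (fun ξ => exp (inner ℝ p.2 ξ)) ξ ∂(M.condKernel.prodMkRight _ p) := by
      ext p
      rw [integral_indicator (hS _)]
      rfl
    rw [h1]
    refine (StronglyMeasurable.integral_kernel_prod_right ?_).measurable
    refine Measurable.stronglyMeasurable ?_
    have : Measurable fun q : (ℝ × EuclideanSpace ℝ (Fin n)) × EuclideanSpace ℝ (Fin n) =>
        exp (inner ℝ q.1.2 q.2) := by fun_prop
    have hS' : MeasurableSet {q : (ℝ × EuclideanSpace ℝ (Fin n)) × EuclideanSpace ℝ (Fin n) |
        ‖q.2‖ ^ 2 = q.1.1} := measurableSet_eq_fun (by fun_prop) (by fun_prop)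
    exact this.indicator hS'
  · refine fun s => ⟨?_, lap_integral_exp_inner (hae s)⟩
    have hr : ∀ᵐ ξ ∂((M.condKernel s).restrict (S s)), ‖ξ‖ ≤ √s := by
      filter_upwards [hae s] with ξ hξ
      rw [← hξ, Real.sqrt_sq (norm_nonneg ξ)]
    refine contDiff_infty.2 fun m => ?_
    simpa using contDiff_integral_exp_inner_smul hr m (g := fun _ => (1 : ℝ)) continuous_const
  · intro x t hint
    set f : ℝ × EuclideanSpace ℝ (Fin n) → ℝ := fun p =>
      exp (t * p.1) * (S p.1).indicator (fun ξ => exp (inner ℝ x ξ)) p.2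
    have hf : Measurable f := by
      have : Measurable fun q : ℝ × EuclideanSpace ℝ (Fin n) => exp (inner ℝ x q.2) := by fun_prop
      exact (by fun_prop : Measurable fun q : ℝ × EuclideanSpace ℝ (Fin n) => exp (t * q.1)).mul
        (this.indicator hSS)
    have hfΦ : ∀ ξ, f (Φ ξ) = exp (inner ℝ x ξ + t * ‖ξ‖ ^ 2) := fun ξ => by
      simp [f, Φ, S, exp_add, mul_comm]
    have hfi : Integrable f M := by
      rw [integrable_map_measure hf.aestronglyMeasurable hΦ.aemeasurable]
      exact hint.congr (Eventually.of_forall fun ξ => (hfΦ ξ).symm)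
    calc ∫ ξ, exp (inner ℝ x ξ + t * ‖ξ‖ ^ 2) ∂ν = ∫ ξ, f (Φ ξ) ∂ν := by simp only [hfΦ]
      _ = ∫ p, f p ∂M := (integral_map hΦ.aemeasurable hf.aestronglyMeasurable).symm
      _ = ∫ p, f p ∂(M.fst ⊗ₘ M.condKernel) := by rw [hM]
      _ = ∫ s, ∫ ξ, f (s, ξ) ∂(M.condKernel s) ∂M.fst := by
        refine Measure.integral_compProd ?_
        rwa [hM]
      _ = _ := by
        refine integral_congr_ae (Eventually.of_forall fun s => ?_)
        simp only [f]
        rw [integral_const_mul, integral_indicator (hS s)]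

section VagueLimit

open CompactlySupported CompactlySupportedContinuousMap

variable {V : Type*} [TopologicalSpace V] [T2Space V] [LocallyCompactSpace V]
  [MeasurableSpace V] [BorelSpace V]

theorem exists_vague_limit {ν : ℕ → Measure V} [∀ k, IsFiniteMeasure (ν k)] {C : ℝ}
    (hν : ∀ k, (ν k).real univ ≤ C) (U : Ultrafilter ℕ) :
    ∃ μ : Measure V, μ.Regular ∧
      ∀ f : C_c(V, ℝ), Tendsto (fun k => ∫ ξ, f ξ ∂(ν k)) U (𝓝 (∫ ξ, f ξ ∂μ)) := by
  have hint : ∀ (f : C_c(V, ℝ)) k, Integrable f (ν k) := fun f k =>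
    f.continuous.integrable_of_hasCompactSupport f.hasCompactSupport
  have hlim : ∀ f : C_c(V, ℝ), ∃ L, Tendsto (fun k => ∫ ξ, f ξ ∂(ν k)) U (𝓝 L) := by
    intro f
    obtain ⟨B, hB⟩ := f.hasCompactSupport.exists_bound_of_continuous f.continuous
    have hmem : ∀ k, ∫ ξ, f ξ ∂(ν k) ∈ Icc (-(|B| * C)) (|B| * C) := fun k => by
      rw [mem_Icc, ← abs_le, ← Real.norm_eq_abs]
      refine (norm_integral_le_of_norm_le_const (C := |B|)
        (Eventually.of_forall fun ξ => (hB ξ).trans (le_abs_self B))).trans ?_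
      gcongr
      exact hν k
    obtain ⟨L, -, hL⟩ := isCompact_Icc.ultrafilter_le_nhds
      (U.map fun k => ∫ ξ, f ξ ∂(ν k)) (le_principal_iff.2
        (Filter.mem_map.2 (Eventually.of_forall hmem)))
    exact ⟨L, hL⟩
  choose L hL using hlim
  let Λ : C_c(V, ℝ) →ₗ[ℝ] ℝ :=
    { toFun := L
      map_add' := fun f g => by
        refine tendsto_nhds_unique (hL (f + g)) (((hL f).add (hL g)).congr fun k => ?_)
        simp [integral_add (hint f k) (hint g k)]
      map_smul' := fun a f => by
        refine tendsto_nhds_unique (hL (a • f)) (((hL f).const_mul a).congr fun k => ?_)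
        simp [integral_const_mul] }
  have hΛ : ∀ f : C_c(V, ℝ), 0 ≤ f → 0 ≤ Λ f := fun f hf =>
    ge_of_tendsto' (hL f) fun k => integral_nonneg hf
  refine ⟨RealRMK.rieszMeasure (PositiveLinearMap.mk₀ Λ hΛ), inferInstance, fun f => ?_⟩
  rw [RealRMK.integral_rieszMeasure]
  exact hL f

theorem exists_measure_lintegral_eq_of_uniform_limit {ν : ℕ → Measure V}
    [∀ k, IsFiniteMeasure (ν k)] {C : ℝ} (hν : ∀ k, (ν k).real univ ≤ C) :
    ∃ μ : Measure V, ∀ (F : V → ℝ) (G : ℕ → V → ℝ) (c : ℝ), Continuous F → (∀ ξ, 0 ≤ F ξ) →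
      Tendsto F (cocompact V) (𝓝 0) → (∀ᶠ k in atTop, Integrable (G k) (ν k)) →
      TendstoUniformly G F atTop → (∀ᶠ k in atTop, ∫ ξ, G k ξ ∂(ν k) = c) →
      ∫⁻ ξ, ENNReal.ofReal (F ξ) ∂μ = ENNReal.ofReal c := by
  obtain ⟨μ, hμ, hlim⟩ := exists_vague_limit hν (hyperfilter ℕ)
  have hU : ((hyperfilter ℕ : Ultrafilter ℕ) : Filter ℕ) ≤ atTop := Nat.hyperfilter_le_atTop
  refine ⟨μ, fun F G c hF hF0 hFc hGi hG hGc => ?_⟩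
  have hC : 0 ≤ C := measureReal_nonneg.trans (hν 0)
  have hcs : ∀ ε : ℝ, 0 < ε → HasCompactSupport fun ξ => max (F ξ - ε) 0 := fun ε hε => by
    obtain ⟨K, hK, hKF⟩ := mem_cocompact.1 (hFc.eventually (gt_mem_nhds hε))
    refine HasCompactSupport.intro hK fun ξ hξ => max_eq_right ?_
    have : F ξ < ε := hKF hξ
    linarith
  have hcont : ∀ ε : ℝ, Continuous fun ξ => max (F ξ - ε) 0 := fun ε => by fun_prop
  have key : ∀ ε : ℝ, 0 < ε → |∫ ξ, max (F ξ - ε) 0 ∂μ - c| ≤ 2 * ε * C := by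
    intro ε hε
    have h1 := hlim ⟨⟨_, hcont ε⟩, hcs ε hε⟩
    simp only [CompactlySupportedContinuousMap.coe_mk, ContinuousMap.coe_mk] at h1
    refine le_of_tendsto ((h1.sub_const c).abs) (hU ?_)
    filter_upwards [hGi, hGc, Metric.tendstoUniformly_iff.1 hG ε hε] with k h2 h3 h4
    have h5 : Integrable (fun ξ => max (F ξ - ε) 0) (ν k) :=
      (hcont ε).integrable_of_hasCompactSupport (hcs ε hε)
    rw [← h3, ← integral_sub h5 h2, ← Real.norm_eq_abs]
    refine (norm_integral_le_of_norm_le_const (C := 2 * ε)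
      (Eventually.of_forall fun ξ => ?_)).trans ?_
    · have h6 := h4 ξ
      rw [Real.dist_eq, abs_lt] at h6
      rw [Real.norm_eq_abs, abs_le]
      have h7 := hF0 ξ
      constructor
      · linarith [le_max_left (F ξ - ε) 0]
      · rcases max_cases (F ξ - ε) 0 with h | h <;> linarith
    · gcongr
      exact hν k
  set e : ℕ → ℝ := fun m => 1 / ((m : ℝ) + 1)
  have he : ∀ m, 0 < e m := fun m => by positivity
  have he0 : Tendsto e atTop (𝓝 0) := tendsto_one_div_add_atTop_nhds_zero_nat
  have hmono : Tendsto (fun m => ∫⁻ ξ, ENNReal.ofReal (max (F ξ - e m) 0) ∂μ) atTop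
      (𝓝 (∫⁻ ξ, ENNReal.ofReal (F ξ) ∂μ)) := by
    refine lintegral_tendsto_of_tendsto_of_monotone (fun m => ?_) ?_ ?_
    · exact (hcont _).measurable.ennreal_ofReal.aemeasurable
    · refine Eventually.of_forall fun ξ i j hij => ?_
      have : e j ≤ e i := one_div_le_one_div_of_le (by positivity) (by gcongr)
      dsimp only
      gcongr
    · refine Eventually.of_forall fun ξ => ENNReal.tendsto_ofReal ?_
      have : Tendsto (fun m => max (F ξ - e m) 0) atTop (𝓝 (max (F ξ - 0) 0)) :=
        (he0.const_sub _).max tendsto_const_nhds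
      simpa [hF0 ξ] using this
  refine tendsto_nhds_unique hmono ?_
  have : ∀ m, ∫⁻ ξ, ENNReal.ofReal (max (F ξ - e m) 0) ∂μ =
      ENNReal.ofReal (∫ ξ, max (F ξ - e m) 0 ∂μ) := fun m =>
    (ofReal_integral_eq_lintegral_ofReal
      ((hcont _).integrable_of_hasCompactSupport (hcs _ (he m)))
      (Eventually.of_forall fun ξ => le_max_right _ _)).symm
  simp only [this]
  refine ENNReal.tendsto_ofReal ?_
  rw [tendsto_iff_norm_sub_tendsto_zero]
  refine squeeze_zero (fun _ => norm_nonneg _) (fun m => key _ (he m)) ?_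
  simpa using (he0.const_mul 2).mul_const C

end VagueLimit

theorem hasDerivAt_max_zero_pow (k : ℕ) (r : ℝ) :
    HasDerivAt (fun r : ℝ => max r 0 ^ (k + 2)) ((k + 2) * max r 0 ^ (k + 1)) r := by
  rcases lt_trichotomy r 0 with hr | rfl | hr
  · have h : (fun r : ℝ => max r 0 ^ (k + 2)) =ᶠ[𝓝 r] fun _ => 0 := by
      filter_upwards [gt_mem_nhds hr] with a ha
      simp [max_eq_right ha.le]
    simpa [max_eq_right hr.le] using (hasDerivAt_const r (0 : ℝ)).congr_of_eventuallyEq h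
  · rw [hasDerivAt_iff_isLittleO_nhds_zero]
    simp only [zero_add, max_self, ne_eq, Nat.add_eq_zero_iff, OfNat.ofNat_ne_zero, and_false,
      not_false_eq_true, zero_pow, sub_zero, one_ne_zero, mul_zero, smul_eq_mul]
    have h1 : (fun h : ℝ => max h 0 ^ (k + 2)) =O[𝓝 0] fun h : ℝ => h ^ (k + 2) := by
      refine Asymptotics.IsBigO.of_bound 1 (Eventually.of_forall fun h => ?_)
      rw [one_mul, norm_pow, norm_pow]
      gcongr
      rw [Real.norm_eq_abs, Real.norm_eq_abs, abs_of_nonneg (le_max_right _ _)]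
      exact max_le (le_abs_self h) (abs_nonneg h)
    refine h1.trans_isLittleO ?_
    simpa using Asymptotics.isLittleO_pow_pow (𝕜 := ℝ) (show 1 < k + 2 by omega)
  · have h : (fun r : ℝ => max r 0 ^ (k + 2)) =ᶠ[𝓝 r] fun r => r ^ (k + 2) := by
      filter_upwards [lt_mem_nhds hr] with a ha
      simp [max_eq_left ha.le]
    have := (hasDerivAt_pow (k + 2) r).congr_of_eventuallyEq h
    simpa [max_eq_left hr.le] using this

section Radial

variable {n : ℕ}

theorem hasDerivAt_norm_sq_line (x y : EuclideanSpace ℝ (Fin n)) (i : Fin n) :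
    HasDerivAt (fun t : ℝ => ‖y + t • EuclideanSpace.single i (1 : ℝ) - x‖ ^ 2)
      (2 * (y - x) i) 0 := by
  have h1 : HasDerivAt (fun t : ℝ => y + t • EuclideanSpace.single i (1 : ℝ) - x)
      (EuclideanSpace.single i (1 : ℝ)) 0 := by
    simpa using (((hasDerivAt_id (0 : ℝ)).smul_const
      (EuclideanSpace.single i (1 : ℝ))).const_add y).sub_const x
  simpa [EuclideanSpace.inner_single_right] using h1.norm_sq

theorem hasLineDerivAt_radial {k k' : ℝ → ℝ} (hk : ∀ q, HasDerivAt k (k' q) q)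
    (x y : EuclideanSpace ℝ (Fin n)) (i : Fin n) :
    HasLineDerivAt ℝ (fun y => k (‖y - x‖ ^ 2)) (2 * (y - x) i * k' (‖y - x‖ ^ 2)) y
      (EuclideanSpace.single i 1) := by
  have h := (hk (‖y + (0 : ℝ) • EuclideanSpace.single i (1 : ℝ) - x‖ ^ 2)).comp 0
    (hasDerivAt_norm_sq_line x y i)
  simp only [zero_smul, add_zero] at h
  rw [mul_comm]
  exact h

theorem hasLineDerivAt_radial_deriv {k' k'' : ℝ → ℝ} (hk : ∀ q, HasDerivAt k' (k'' q) q)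
    (x y : EuclideanSpace ℝ (Fin n)) (i : Fin n) :
    HasLineDerivAt ℝ (fun y => 2 * (y - x) i * k' (‖y - x‖ ^ 2))
      (2 * k' (‖y - x‖ ^ 2) + 4 * (y - x) i ^ 2 * k'' (‖y - x‖ ^ 2)) y
      (EuclideanSpace.single i 1) := by
  have h1 : HasDerivAt (fun t : ℝ => 2 * (y + t • EuclideanSpace.single i (1 : ℝ) - x) i) 2 0 := by
    have : (fun t : ℝ => 2 * (y + t • EuclideanSpace.single i (1 : ℝ) - x) i) =
        fun t => 2 * (y i + t - x i) := by
      ext t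
      simp
    rw [this]
    simpa using (((hasDerivAt_id (0 : ℝ)).const_add (y i)).sub_const (x i)).const_mul 2
  have h2 := h1.mul (hasLineDerivAt_radial hk x y i)
  simp only [zero_smul, add_zero] at h2
  refine HasDerivAt.congr_deriv h2 ?_
  ring

theorem hasCompactSupport_of_radial {r : ℝ} {f : EuclideanSpace ℝ (Fin n) → ℝ}
    (x : EuclideanSpace ℝ (Fin n)) (hf : ∀ y, r ≤ ‖y - x‖ ^ 2 → f y = 0) : HasCompactSupport f := by
  refine HasCompactSupport.intro (isCompact_closedBall x √r) fun y hy => hf y ?_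
  rw [Metric.mem_closedBall, dist_eq_norm, not_le] at hy
  exact (Real.lt_sq_of_sqrt_lt hy).le

theorem integral_radial_mul_lap {k k' k'' : ℝ → ℝ} {r : ℝ} (hk : ∀ q, HasDerivAt k (k' q) q)
    (hk' : ∀ q, HasDerivAt k' (k'' q) q) (hk'' : Continuous k'') (h0 : ∀ q, r ≤ q → k q = 0)
    (h0' : ∀ q, r ≤ q → k' q = 0) (h0'' : ∀ q, r ≤ q → k'' q = 0)
    {f : EuclideanSpace ℝ (Fin n) → ℝ} (hf : ContDiff ℝ (⊤ : ℕ∞) f)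
    (x : EuclideanSpace ℝ (Fin n)) :
    ∫ y, k (‖y - x‖ ^ 2) * lap n f y =
      ∫ y, (2 * n * k' (‖y - x‖ ^ 2) + 4 * ‖y - x‖ ^ 2 * k'' (‖y - x‖ ^ 2)) * f y := by
  have ck : Continuous k := continuous_iff_continuousAt.2 fun q => (hk q).continuousAt
  have ck' : Continuous k' := continuous_iff_continuousAt.2 fun q => (hk' q).continuousAt
  have hf1 : ∀ v : EuclideanSpace ℝ (Fin n), ContDiff ℝ (⊤ : ℕ∞) fun y => fderiv ℝ f y v :=
    fun v => (hf.fderiv_right (by norm_cast)).clm_apply contDiff_const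
  have hf2 : ∀ v w : EuclideanSpace ℝ (Fin n),
      Continuous fun y => fderiv ℝ (fun y => fderiv ℝ f y v) y w :=
    fun v w => (((hf1 v).fderiv_right (m := (⊤ : ℕ∞)) (by norm_cast)).clm_apply
      contDiff_const).continuous
  have hint : ∀ {a b : EuclideanSpace ℝ (Fin n) → ℝ}, Continuous a → Continuous b →
      (∀ y, r ≤ ‖y - x‖ ^ 2 → a y = 0) → Integrable fun y => a y * b y := fun ha hb h =>
    (ha.mul hb).integrable_of_hasCompactSupport
      ((hasCompactSupport_of_radial x h).mul_right)
  have key : ∀ i : Fin n, ∫ y, k (‖y - x‖ ^ 2) * fderiv ℝ (fun y => fderiv ℝ f y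
      (EuclideanSpace.single i 1)) y (EuclideanSpace.single i 1) =
      ∫ y, (2 * k' (‖y - x‖ ^ 2) + 4 * (y - x) i ^ 2 * k'' (‖y - x‖ ^ 2)) * f y := by
    intro i
    have e1 := integral_bilinear_hasLineDerivAt_right_eq_neg_left_of_integrable
      (μ := volume) (B := ContinuousLinearMap.mul ℝ ℝ)
      (f := fun y => k (‖y - x‖ ^ 2)) (f' := fun y => 2 * (y - x) i * k' (‖y - x‖ ^ 2))
      (g := fun y => fderiv ℝ f y (EuclideanSpace.single i 1))
      (g' := fun y => fderiv ℝ (fun y => fderiv ℝ f y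
        (EuclideanSpace.single i 1)) y (EuclideanSpace.single i 1))
      (v := EuclideanSpace.single i 1)
      (hint (by fun_prop) (hf1 _).continuous fun y hy => by simp [h0' _ hy])
      (hint (by fun_prop) (hf2 _ _) fun y hy => h0 _ hy)
      (hint (by fun_prop) (hf1 _).continuous fun y hy => h0 _ hy)
      (fun y _ => hasLineDerivAt_radial hk x y i)
      (fun y _ => (((hf1 _).differentiable (by simp)) y).hasFDerivAt.hasLineDerivAt _)
    have e2 := integral_bilinear_hasLineDerivAt_right_eq_neg_left_of_integrable
      (μ := volume) (B := ContinuousLinearMap.mul ℝ ℝ)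
      (f := fun y => 2 * (y - x) i * k' (‖y - x‖ ^ 2))
      (f' := fun y => 2 * k' (‖y - x‖ ^ 2) + 4 * (y - x) i ^ 2 * k'' (‖y - x‖ ^ 2))
      (g := f) (g' := fun y => fderiv ℝ f y (EuclideanSpace.single i 1))
      (v := EuclideanSpace.single i 1)
      (hint (by fun_prop) hf.continuous fun y hy => by simp [h0' _ hy, h0'' _ hy])
      (hint (by fun_prop) (hf1 _).continuous fun y hy => by simp [h0' _ hy])
      (hint (by fun_prop) hf.continuous fun y hy => by simp [h0' _ hy])
      (fun y _ => hasLineDerivAt_radial_deriv hk' x y i)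
      (fun y _ => ((hf.differentiable (by simp)) y).hasFDerivAt.hasLineDerivAt _)
    simp only [ContinuousLinearMap.mul_apply'] at e1 e2
    rw [e1, e2, neg_neg]
  simp only [lap, Finset.mul_sum]
  rw [integral_finsetSum]
  · simp only [key]
    rw [← integral_finsetSum]
    · refine integral_congr_ae (Eventually.of_forall fun y => ?_)
      simp only [← Finset.sum_mul, Finset.sum_add_distrib, Finset.sum_const, Finset.card_univ,
        Fintype.card_fin, nsmul_eq_mul]
      congr 2
      · ring
      · rw [EuclideanSpace.norm_sq_eq, Finset.mul_sum]
        simp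
    · exact fun i _ => hint (by fun_prop) hf.continuous fun y hy => by simp [h0' _ hy, h0'' _ hy]
  · exact fun i _ => hint (by fun_prop) (hf2 _ _) fun y hy => h0 _ hy

end Radial

section Cutoff

variable {n : ℕ}

/-- The Gaussian heat kernel on `ℝⁿ` at time `τ`. -/
def heatKernel (n : ℕ) (τ : ℝ) (z : EuclideanSpace ℝ (Fin n)) : ℝ :=
  (4 * π * τ) ^ (-(n : ℝ) / 2) * exp (-‖z‖ ^ 2 / (4 * τ))

theorem heatKernel_nonneg {τ : ℝ} (hτ : 0 ≤ τ) (z : EuclideanSpace ℝ (Fin n)) :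
    0 ≤ heatKernel n τ z := by
  unfold heatKernel
  positivity

theorem continuous_heatKernel (τ : ℝ) : Continuous (heatKernel n τ) := by
  unfold heatKernel
  fun_prop

theorem continuousOn_heatKernel_sub (t : ℝ) (x : EuclideanSpace ℝ (Fin n)) :
    ContinuousOn (fun p : ℝ × EuclideanSpace ℝ (Fin n) => heatKernel n (t - p.1) (p.2 - x))
      (Iio t ×ˢ univ) := by
  unfold heatKernel
  have h : ∀ p ∈ Iio t ×ˢ (univ : Set (EuclideanSpace ℝ (Fin n))), 0 < t - p.1 :=
    fun p hp => sub_pos.2 hp.1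
  refine ContinuousOn.mul (ContinuousOn.rpow_const (by fun_prop) fun p hp => Or.inl ?_)
    (ContinuousOn.rexp (ContinuousOn.div (by fun_prop) (by fun_prop) fun p hp => ?_))
  · have := h p hp
    positivity
  · have := h p hp
    positivity

theorem hasDerivAt_heatKernel {τ : ℝ} (hτ : 0 < τ) (z : EuclideanSpace ℝ (Fin n)) :
    HasDerivAt (fun τ => heatKernel n τ z)
      (heatKernel n τ z * (-n / (2 * τ) + ‖z‖ ^ 2 / (4 * τ ^ 2))) τ := by
  have h1 : HasDerivAt (fun τ : ℝ => (4 * π * τ) ^ (-(n : ℝ) / 2))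
      (4 * π * (-(n : ℝ) / 2) * (4 * π * τ) ^ (-(n : ℝ) / 2 - 1)) τ := by
    have := ((hasDerivAt_id τ).const_mul (4 * π)).rpow_const (p := -(n : ℝ) / 2)
      (Or.inl (by simp only [id]; positivity))
    simpa using this
  have h2 : HasDerivAt (fun τ : ℝ => exp (-‖z‖ ^ 2 / (4 * τ)))
      (exp (-‖z‖ ^ 2 / (4 * τ)) * (‖z‖ ^ 2 / (4 * τ ^ 2))) τ := by
    have := (((hasDerivAt_const τ (-‖z‖ ^ 2)).div ((hasDerivAt_id τ).const_mul 4)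
      (by simp only [id]; positivity))).exp
    refine this.congr_deriv ?_
    simp only [Pi.div_apply, id]
    field_simp
    ring
  refine (h1.mul h2).congr_deriv ?_
  unfold heatKernel
  rw [rpow_sub_one (by positivity)]
  field_simp

theorem hasDerivAt_integral_of_compact_support {f f' : ℝ → EuclideanSpace ℝ (Fin n) → ℝ}
    {t s : ℝ} {K : Set (EuclideanSpace ℝ (Fin n))} (hK : IsCompact K) (hs : s < t)
    (hf : ContinuousOn (Function.uncurry f) (Iio t ×ˢ univ))
    (hf' : ContinuousOn (Function.uncurry f') (Iio t ×ˢ univ))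
    (h0 : ∀ s y, y ∉ K → f s y = 0) (h0' : ∀ s y, y ∉ K → f' s y = 0)
    (hderiv : ∀ s < t, ∀ y, HasDerivAt (fun s => f s y) (f' s y) s) :
    HasDerivAt (fun s => ∫ y, f s y) (∫ y, f' s y) s := by
  have hslice : ∀ {g : ℝ → EuclideanSpace ℝ (Fin n) → ℝ} {a}, a < t →
      ContinuousOn (Function.uncurry g) (Iio t ×ˢ univ) → Continuous (g a) := by
    intro g a ha hg
    rw [← continuousOn_univ]
    exact hg.comp (f := fun y => (a, y)) (by fun_prop) fun y _ => ⟨ha, mem_univ _⟩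
  obtain ⟨ε, hε, hεt⟩ : ∃ ε > 0, s + ε < t := ⟨(t - s) / 2, by linarith, by linarith⟩
  have hsub : Metric.closedBall s ε ×ˢ K ⊆ Iio t ×ˢ univ := by
    refine prod_mono (fun a ha => ?_) (subset_univ _)
    rw [Metric.mem_closedBall, Real.dist_eq, abs_le] at ha
    exact show a < t by linarith
  obtain ⟨M, hM⟩ := ((isCompact_closedBall s ε).prod hK).exists_bound_of_continuousOn
    (hf'.mono hsub)
  have hball : ∀ a ∈ Metric.ball s ε, a < t := by
    intro a ha
    rw [Metric.mem_ball, Real.dist_eq, abs_lt] at ha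
    linarith
  refine (hasDerivAt_integral_of_dominated_loc_of_deriv_le (μ := volume)
    (bound := K.indicator fun _ => M) (Metric.ball_mem_nhds s hε) ?_ ?_ ?_ ?_ ?_ ?_).2
  · filter_upwards [Metric.ball_mem_nhds s hε] with a ha
    exact (hslice (hball a ha) hf).aestronglyMeasurable
  · exact (hslice hs hf).integrable_of_hasCompactSupport (HasCompactSupport.intro hK (h0 s))
  · exact (hslice hs hf').aestronglyMeasurable
  · refine Eventually.of_forall fun y a ha => ?_
    by_cases hy : y ∈ K
    · rw [indicator_of_mem hy]
      exact hM (a, y) ⟨Metric.ball_subset_closedBall ha, hy⟩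
    · rw [indicator_of_notMem hy, h0' _ _ hy, norm_zero]
  · exact (integrable_indicator_iff hK.measurableSet).2
      (integrableOn_const hK.measure_lt_top.ne)
  · exact Eventually.of_forall fun y a ha => hderiv a (hball a ha) y

theorem max_cutoff_eq_zero {r : ℝ} (hr : 0 < r) {x y : EuclideanSpace ℝ (Fin n)}
    (hy : y ∉ Metric.closedBall x √(1 / r)) : max (1 - r * ‖y - x‖ ^ 2) 0 = 0 := by
  rw [Metric.mem_closedBall, dist_eq_norm, not_le] at hy
  have h1 := Real.lt_sq_of_sqrt_lt hy
  rw [div_lt_iff₀ hr] at h1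
  exact max_eq_right (by linarith)

theorem integrable_of_cutoff {r : ℝ} (hr : 0 < r) (x : EuclideanSpace ℝ (Fin n))
    {f : EuclideanSpace ℝ (Fin n) → ℝ} (hf : Continuous f)
    (h : ∀ y, max (1 - r * ‖y - x‖ ^ 2) 0 = 0 → f y = 0) : Integrable f :=
  hf.integrable_of_hasCompactSupport (HasCompactSupport.intro (isCompact_closedBall x √(1 / r))
    fun _ hy => h _ (max_cutoff_eq_zero hr hy))

theorem hasDerivAt_integral_heatKernel_mul_cutoff {u : EuclideanSpace ℝ (Fin n) × ℝ → ℝ}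
    (hu : IsAncientHeat n u) {r : ℝ} (hr : 0 < r) (x : EuclideanSpace ℝ (Fin n)) {s t : ℝ}
    (hs : s < t) (ht : t ≤ 0) :
    HasDerivAt (fun s => ∫ y, heatKernel n (t - s) (y - x) *
        (max (1 - r * ‖y - x‖ ^ 2) 0 ^ 3 * u (y, s)))
      (∫ y, heatKernel n (t - s) (y - x) * ((-(6 * n * r) * max (1 - r * ‖y - x‖ ^ 2) 0 ^ 2 +
        6 * r * ‖y - x‖ ^ 2 / (t - s) * max (1 - r * ‖y - x‖ ^ 2) 0 ^ 2 +
        24 * r ^ 2 * ‖y - x‖ ^ 2 * max (1 - r * ‖y - x‖ ^ 2) 0) * u (y, s))) s := by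
  have hu1 : Continuous fun p : ℝ × EuclideanSpace ℝ (Fin n) => u (p.2, p.1) :=
    hu.1.continuous.comp (by fun_prop)
  have hu2 : Continuous fun p : ℝ × EuclideanSpace ℝ (Fin n) =>
      fderiv ℝ u (p.2, p.1) ((0 : EuclideanSpace ℝ (Fin n)), (1 : ℝ)) :=
    (((hu.1.fderiv_right (m := (⊤ : ℕ∞)) (by norm_cast)).clm_apply
      contDiff_const).continuous).comp (by fun_prop : Continuous fun p :
        ℝ × EuclideanSpace ℝ (Fin n) => (p.2, p.1))
  have hut : ∀ y s, HasDerivAt (fun s => u (y, s))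
      (fderiv ℝ u (y, s) ((0 : EuclideanSpace ℝ (Fin n)), (1 : ℝ))) s := by
    intro y s
    have h1 := ((hu.1.differentiable (by simp)) (y, s)).hasFDerivAt
    exact h1.comp_hasDerivAt s ((hasDerivAt_const s y).prodMk (hasDerivAt_id s))
  have hcw : Continuous fun p : ℝ × EuclideanSpace ℝ (Fin n) =>
      max (1 - r * ‖p.2 - x‖ ^ 2) 0 ^ 3 := by fun_prop
  have hcut : ∀ y ∉ Metric.closedBall x √(1 / r), max (1 - r * ‖y - x‖ ^ 2) 0 = 0 :=
    fun y hy => max_cutoff_eq_zero hr hy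
  have hmain := hasDerivAt_integral_of_compact_support (t := t) (s := s)
    (f := fun s y => heatKernel n (t - s) (y - x) *
        (max (1 - r * ‖y - x‖ ^ 2) 0 ^ 3 * u (y, s)))
    (f' := fun s y => -(heatKernel n (t - s) (y - x) *
        (-n / (2 * (t - s)) + ‖y - x‖ ^ 2 / (4 * (t - s) ^ 2))) *
        (max (1 - r * ‖y - x‖ ^ 2) 0 ^ 3 * u (y, s)) + heatKernel n (t - s) (y - x) *
        (max (1 - r * ‖y - x‖ ^ 2) 0 ^ 3 *
          fderiv ℝ u (y, s) ((0 : EuclideanSpace ℝ (Fin n)), (1 : ℝ))))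
    (isCompact_closedBall x √(1 / r)) hs ?_ ?_ ?_ ?_ ?_
  · refine hmain.congr_deriv ?_
    set b := 1 / (4 * (t - s)) with hb
    have hτ : 0 < t - s := sub_pos.2 hs
    have hus : ContDiff ℝ (⊤ : ℕ∞) fun y => u (y, s) :=
      hu.1.comp (contDiff_id.prodMk contDiff_const)
    have hw : ∀ (k : ℕ) q, HasDerivAt (fun q => max (1 - r * q) 0 ^ (k + 2))
        (-r * ((k + 2) * max (1 - r * q) 0 ^ (k + 1))) q := by
      intro k q
      refine ((hasDerivAt_max_zero_pow k (1 - r * q)).comp q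
        (((hasDerivAt_id q).const_mul r).const_sub 1)).congr_deriv ?_
      ring
    have he : ∀ q, HasDerivAt (fun q => exp (-b * q)) (exp (-b * q) * -b) q := by
      intro q
      simpa using ((hasDerivAt_id q).const_mul (-b)).exp
    have hvan : ∀ q, 1 / r ≤ q → max (1 - r * q) 0 = 0 := by
      intro q hq
      rw [div_le_iff₀ hr] at hq
      exact max_eq_right (by linarith)
    have hrad := integral_radial_mul_lap (r := 1 / r)
      (k := fun q => exp (-b * q) * max (1 - r * q) 0 ^ 3)
      (k' := fun q => -exp (-b * q) *
        (b * max (1 - r * q) 0 ^ 3 + 3 * r * max (1 - r * q) 0 ^ 2))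
      (k'' := fun q => exp (-b * q) * (b ^ 2 * max (1 - r * q) 0 ^ 3 +
        6 * b * r * max (1 - r * q) 0 ^ 2 + 6 * r ^ 2 * max (1 - r * q) 0))
      (fun q => ((he q).mul (hw 1 q)).congr_deriv (by push_cast; ring))
      (fun q => ((he q).neg.mul (((hw 1 q).const_mul b).add
        ((hw 0 q).const_mul (3 * r)))).congr_deriv (by push_cast; simp; ring))
      (by fun_prop) (fun q hq => by simp [hvan q hq]) (fun q hq => by simp [hvan q hq])
      (fun q hq => by simp [hvan q hq]) hus x
    have hK : ∀ y, heatKernel n (t - s) (y - x) =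
        (4 * π * (t - s)) ^ (-(n : ℝ) / 2) * exp (-b * ‖y - x‖ ^ 2) := by
      intro y
      rw [heatKernel, hb]
      congr 2
      ring
    have hheat : ∀ y, fderiv ℝ u (y, s) ((0 : EuclideanSpace ℝ (Fin n)), (1 : ℝ)) =
        lap n (fun y => u (y, s)) y := fun y => by
      rw [hu.2 y s (hs.le.trans ht), (hut y s).deriv]
    have huc := hu.1.continuous
    have hcK : Continuous fun y => heatKernel n (t - s) (y - x) :=
      (continuous_heatKernel (t - s)).comp (by fun_prop)
    have hd2 : Continuous fun y => fderiv ℝ u (y, s) ((0 : EuclideanSpace ℝ (Fin n)), (1 : ℝ)) :=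
      hu2.comp (by fun_prop : Continuous fun y => (s, y))
    have hI1 : Integrable fun y => -(heatKernel n (t - s) (y - x) *
        (-n / (2 * (t - s)) + ‖y - x‖ ^ 2 / (4 * (t - s) ^ 2))) *
        (max (1 - r * ‖y - x‖ ^ 2) 0 ^ 3 * u (y, s)) :=
      integrable_of_cutoff hr x (by fun_prop) fun y hy => by simp [hy]
    rw [integral_add]
    · have e : ∫ y, heatKernel n (t - s) (y - x) * (max (1 - r * ‖y - x‖ ^ 2) 0 ^ 3 *
          fderiv ℝ u (y, s) ((0 : EuclideanSpace ℝ (Fin n)), (1 : ℝ))) =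
          (4 * π * (t - s)) ^ (-(n : ℝ) / 2) * ∫ y, exp (-b * ‖y - x‖ ^ 2) *
            max (1 - r * ‖y - x‖ ^ 2) 0 ^ 3 * lap n (fun y => u (y, s)) y := by
        rw [← integral_const_mul]
        refine integral_congr_ae (Eventually.of_forall fun y => ?_)
        simp only [hK, hheat]
        ring
      rw [e, hrad, ← integral_const_mul, ← integral_add]
      · refine integral_congr_ae (Eventually.of_forall fun y => ?_)
        simp only [hK]
        rw [hb]
        field_simp
        ring
      · exact hI1
      · exact integrable_of_cutoff hr x (by fun_prop) fun y hy => by simp [hy]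
    · exact hI1
    · exact integrable_of_cutoff hr x (by fun_prop) fun y hy => by simp [hy]
  · exact (continuousOn_heatKernel_sub t x).mul (hcw.mul hu1).continuousOn
  · have h : ∀ p ∈ Iio t ×ˢ (univ : Set (EuclideanSpace ℝ (Fin n))), 0 < t - p.1 :=
      fun p hp => sub_pos.2 hp.1
    refine ContinuousOn.add (ContinuousOn.mul (ContinuousOn.neg
      ((continuousOn_heatKernel_sub t x).mul (ContinuousOn.add (ContinuousOn.div (by fun_prop)
        (by fun_prop) fun p hp => ?_) (ContinuousOn.div (by fun_prop)
        (by fun_prop) fun p hp => ?_)))) (hcw.mul hu1).continuousOn)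
      ((continuousOn_heatKernel_sub t x).mul (hcw.mul hu2).continuousOn) <;>
    · have := h p hp
      positivity
  · intro s y hy
    simp [hcut y hy]
  · intro s y hy
    simp [hcut y hy]
  · intro s hs y
    have h1 := ((hasDerivAt_heatKernel (sub_pos.2 hs) (y - x)).comp s
      ((hasDerivAt_id s).const_sub t)).mul ((hut y s).const_mul (max (1 - r * ‖y - x‖ ^ 2) 0 ^ 3))
    refine h1.congr_deriv ?_
    simp only [Function.comp]
    ring

end Cutoff

section InitialLimit

variable {n : ℕ}

theorem integrable_heatKernel {τ : ℝ} (hτ : 0 < τ) : Integrable (heatKernel n τ) := by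
  have h := (GaussianFourier.integrable_cexp_neg_mul_sq_norm_add (b := ((1 / (4 * τ) : ℝ) : ℂ))
    (by rw [Complex.ofReal_re]; positivity) 0 (0 : EuclideanSpace ℝ (Fin n))).norm
  refine (h.const_mul ((4 * π * τ) ^ (-(n : ℝ) / 2))).congr (Eventually.of_forall fun z => ?_)
  simp only [heatKernel, Complex.norm_exp]
  congr 2
  norm_cast
  simp
  ring

theorem integral_heatKernel {τ : ℝ} (hτ : 0 < τ) : ∫ z, heatKernel n τ z = 1 := by
  have h := GaussianFourier.integral_rexp_neg_mul_sq_norm (V := EuclideanSpace ℝ (Fin n))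
    (b := 1 / (4 * τ)) (by positivity)
  have e : ∀ z : EuclideanSpace ℝ (Fin n), heatKernel n τ z =
      (4 * π * τ) ^ (-(n : ℝ) / 2) * exp (-(1 / (4 * τ)) * ‖z‖ ^ 2) := fun z => by
    rw [heatKernel]
    congr 2
    ring
  simp only [e]
  rw [integral_const_mul, h, finrank_euclideanSpace, Fintype.card_fin, neg_div,
    rpow_neg (by positivity), show π / (1 / (4 * τ)) = 4 * π * τ by field_simp]
  exact inv_mul_cancel₀ (by positivity)

theorem heatKernel_smul {a τ : ℝ} (ha : 0 < a) (hτ : 0 < τ) (z : EuclideanSpace ℝ (Fin n)) :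
    heatKernel n (a ^ 2 * τ) (a • z) = (a ^ n)⁻¹ * heatKernel n τ z := by
  have h1 : (4 * π * (a ^ 2 * τ)) ^ (-(n : ℝ) / 2) =
      (a ^ n)⁻¹ * (4 * π * τ) ^ (-(n : ℝ) / 2) := by
    rw [show 4 * π * (a ^ 2 * τ) = a ^ 2 * (4 * π * τ) by ring,
      mul_rpow (by positivity) (by positivity), ← rpow_natCast a 2, ← rpow_mul ha.le,
      ← rpow_natCast a n, ← rpow_neg ha.le]
    congr 2
    push_cast
    ring
  rw [heatKernel, h1, heatKernel, norm_smul, mul_pow, Real.norm_of_nonneg ha.le, mul_assoc]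
  congr 3
  field_simp

theorem integral_heatKernel_sub_mul {τ : ℝ} (hτ : 0 < τ) (x : EuclideanSpace ℝ (Fin n))
    (g : EuclideanSpace ℝ (Fin n) → ℝ) :
    ∫ y, heatKernel n τ (y - x) * g y = ∫ z, heatKernel n 1 z * g (x + √τ • z) := by
  have hs : 0 < √τ := sqrt_pos.2 hτ
  rw [← integral_add_right_eq_self _ x]
  have h := Measure.integral_comp_smul (volume : Measure (EuclideanSpace ℝ (Fin n)))
    (fun y => heatKernel n τ y * g (x + y)) √τ
  rw [finrank_euclideanSpace, Fintype.card_fin, abs_of_pos (by positivity), smul_eq_mul,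
    eq_inv_mul_iff_mul_eq₀ (by positivity)] at h
  simp only [add_comm _ x, add_sub_cancel_left]
  rw [← h, ← integral_const_mul]
  refine integral_congr_ae (Eventually.of_forall fun z => ?_)
  have := heatKernel_smul (n := n) hs one_pos z
  rw [sq_sqrt hτ.le, mul_one] at this
  simp only [this]
  field_simp

theorem tendsto_integral_heatKernel_mul {g : ℝ × EuclideanSpace ℝ (Fin n) → ℝ}
    (hg : Continuous g) {M : ℝ} (hM : ∀ τ ∈ Ioo (0 : ℝ) 1, ∀ y, |g (τ, y)| ≤ M)
    (x : EuclideanSpace ℝ (Fin n)) :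
    Tendsto (fun τ => ∫ y, heatKernel n τ (y - x) * g (τ, y)) (𝓝[>] 0) (𝓝 (g (0, x))) := by
  have h : Tendsto (fun τ => ∫ z, heatKernel n 1 z * g (τ, x + √τ • z)) (𝓝[>] 0)
      (𝓝 (∫ z, heatKernel n 1 z * g (0, x))) := by
    refine tendsto_integral_filter_of_dominated_convergence (fun z => heatKernel n 1 z * M)
      ?_ ?_ ((integrable_heatKernel one_pos).mul_const M) ?_
    · refine Eventually.of_forall fun τ => Continuous.aestronglyMeasurable ?_
      exact (continuous_heatKernel 1).mul (by fun_prop)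
    · filter_upwards [Ioo_mem_nhdsGT one_pos] with τ hτ
      refine Eventually.of_forall fun z => ?_
      rw [norm_mul, Real.norm_of_nonneg (heatKernel_nonneg zero_le_one z)]
      exact mul_le_mul_of_nonneg_left (hM τ hτ _) (heatKernel_nonneg zero_le_one z)
    · refine Eventually.of_forall fun z => Tendsto.const_mul _ ?_
      have : Continuous fun τ : ℝ => g (τ, x + √τ • z) := by fun_prop
      simpa using (this.tendsto 0).mono_left nhdsWithin_le_nhds
  rw [integral_mul_const, integral_heatKernel one_pos, one_mul] at h
  refine h.congr' ?_
  filter_upwards [self_mem_nhdsWithin] with τ hτ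
  rw [integral_heatKernel_sub_mul hτ x fun y => g (τ, y)]

end InitialLimit

section MeanValue

variable {n : ℕ} {u : EuclideanSpace ℝ (Fin n) × ℝ → ℝ}

/-- The backward heat average of `u`, truncated to the ball of radius `r ^ (-1/2)` about `x`. -/
def truncatedHeatMean (u : EuclideanSpace ℝ (Fin n) × ℝ → ℝ) (r : ℝ) (x : EuclideanSpace ℝ (Fin n))
    (t s : ℝ) : ℝ :=
  ∫ y, heatKernel n (t - s) (y - x) * (max (1 - r * ‖y - x‖ ^ 2) 0 ^ 3 * u (y, s))

theorem tendsto_truncatedHeatMean (hu : IsAncientHeat n u) {r : ℝ} (hr : 0 < r)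
    (x : EuclideanSpace ℝ (Fin n)) (t : ℝ) :
    Tendsto (truncatedHeatMean u r x t) (𝓝[<] t) (𝓝 (u (x, t))) := by
  have huc := hu.1.continuous
  have hg : Continuous fun p : ℝ × EuclideanSpace ℝ (Fin n) =>
      max (1 - r * ‖p.2 - x‖ ^ 2) 0 ^ 3 * u (p.2, t - p.1) := by fun_prop
  obtain ⟨M, hM⟩ := ((isCompact_Icc (a := (0 : ℝ)) (b := 1)).prod
    (isCompact_closedBall x √(1 / r))).exists_bound_of_continuousOn hg.continuousOn
  have hM' : ∀ τ ∈ Ioo (0 : ℝ) 1, ∀ y : EuclideanSpace ℝ (Fin n),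
      |max (1 - r * ‖y - x‖ ^ 2) 0 ^ 3 * u (y, t - τ)| ≤ |M| := by
    intro τ hτ y
    by_cases hy : y ∈ Metric.closedBall x √(1 / r)
    · exact (hM (τ, y) ⟨Ioo_subset_Icc_self hτ, hy⟩).trans (le_abs_self M)
    · simp [max_cutoff_eq_zero hr hy]
  have h := tendsto_integral_heatKernel_mul hg hM' x
  simp only [sub_self, norm_zero, ne_eq, OfNat.ofNat_ne_zero, not_false_eq_true, zero_pow,
    mul_zero, sub_zero, zero_le_one, sup_of_le_left, one_pow, one_mul] at h
  have h2 : Tendsto (fun s => t - s) (𝓝[<] t) (𝓝[>] 0) := by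
    refine tendsto_nhdsWithin_iff.2 ⟨?_, ?_⟩
    · have : Continuous fun s => t - s := by fun_prop
      simpa using (this.tendsto t).mono_left nhdsWithin_le_nhds
    · filter_upwards [self_mem_nhdsWithin] with s hs using sub_pos.2 (mem_Iio.1 hs)
  refine (h.comp h2).congr fun s => ?_
  simp [truncatedHeatMean]

theorem cutoff_coefficient_nonneg {r q τ N : ℝ} (hr : 0 < r) (hq : 0 ≤ q) (hτ : 0 < τ)
    (hN : 0 ≤ N) (h : N * r * τ ≤ 1 / 2) :
    0 ≤ 12 * N * r * max (1 - r * q) 0 ^ 3 + (-(6 * N * r) * max (1 - r * q) 0 ^ 2 +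
      6 * r * q / τ * max (1 - r * q) 0 ^ 2 + 24 * r ^ 2 * q * max (1 - r * q) 0) := by
  have hw : 0 ≤ max (1 - r * q) 0 := le_max_right _ _
  have hw' := le_max_left (1 - r * q) 0
  set w := max (1 - r * q) 0
  have h4 : 0 ≤ 24 * r ^ 2 * q * w := by positivity
  rcases le_total (N * τ) q with h1 | h1
  · have h2 : N ≤ q / τ := (le_div_iff₀ hτ).2 h1
    have h3 : 6 * N * r * w ^ 2 ≤ 6 * r * q / τ * w ^ 2 := by
      refine mul_le_mul_of_nonneg_right ?_ (by positivity)
      rw [mul_div_assoc]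
      nlinarith
    have h5 : 0 ≤ 12 * N * r * w ^ 3 := by positivity
    linarith
  · have h2 : 1 / 2 ≤ w := by nlinarith
    have h3 : 0 ≤ 6 * N * r * w ^ 2 * (2 * w - 1) :=
      mul_nonneg (by positivity) (by linarith)
    have h5 : 0 ≤ 6 * r * q / τ * w ^ 2 := by positivity
    linarith

theorem truncatedHeatMean_le (hu : IsAncientHeat n u)
    (hnonneg : ∀ (x : EuclideanSpace ℝ (Fin n)) (t : ℝ), t ≤ 0 → 0 ≤ u (x, t)) {r T t : ℝ}
    (hr : 0 < r) (hT : 0 < T) (ht : t ≤ 0) (h : n * r * T ≤ 1 / 2)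
    (x : EuclideanSpace ℝ (Fin n)) :
    truncatedHeatMean u r x t (t - T) ≤ exp (12 * n * r * T) * u (x, t) := by
  have huc := hu.1.continuous
  have hd : ∀ s < t, HasDerivAt (fun s => exp (12 * n * r * s) * truncatedHeatMean u r x t s)
      _ s := fun s hs => (((hasDerivAt_id s).const_mul (12 * n * r)).exp).mul
        (hasDerivAt_integral_heatKernel_mul_cutoff hu hr x hs ht)
  have hmono : MonotoneOn (fun s => exp (12 * n * r * s) * truncatedHeatMean u r x t s)
      (Ico (t - T) t) := by
    refine monotoneOn_of_deriv_nonneg (convex_Ico _ _)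
      (fun s hs => (hd s hs.2).continuousAt.continuousWithinAt)
      (fun s hs => (hd s (interior_subset hs).2).differentiableAt.differentiableWithinAt) ?_
    intro s hs
    have hs' := interior_subset hs
    have hτ : 0 < t - s := sub_pos.2 hs'.2
    rw [(hd s hs'.2).deriv]
    have hcK : Continuous fun y => heatKernel n (t - s) (y - x) :=
      (continuous_heatKernel (t - s)).comp (by fun_prop)
    have e : ∀ a b e : ℝ, e * a * b = e * (a * b) := fun a b e => by ring
    simp only [id, mul_one]
    rw [mul_assoc, ← mul_add]
    refine mul_nonneg (exp_pos _).le ?_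
    rw [truncatedHeatMean, ← integral_const_mul, ← integral_add]
    · refine integral_nonneg fun y => ?_
      have hc := cutoff_coefficient_nonneg (r := r) (q := ‖y - x‖ ^ 2) (N := n) hr
        (by positivity) hτ (by positivity) (le_trans (by gcongr; linarith [hs'.1]) h)
      have := mul_nonneg (mul_nonneg (heatKernel_nonneg hτ.le (y - x)) hc)
        (hnonneg y s (hs'.2.le.trans ht))
      refine this.trans_eq ?_
      ring
    · exact integrable_of_cutoff hr x (by fun_prop) fun y hy => by simp [hy]
    · exact integrable_of_cutoff hr x (by fun_prop) fun y hy => by simp [hy]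
  have hlim : Tendsto (fun s => exp (12 * n * r * s) * truncatedHeatMean u r x t s) (𝓝[<] t)
      (𝓝 (exp (12 * n * r * t) * u (x, t))) := by
    refine Tendsto.mul ?_ (tendsto_truncatedHeatMean hu hr x t)
    have : Continuous fun s => exp (12 * n * r * s) := by fun_prop
    exact (this.tendsto t).mono_left nhdsWithin_le_nhds
  have hle : exp (12 * n * r * (t - T)) * truncatedHeatMean u r x t (t - T) ≤
      exp (12 * n * r * t) * u (x, t) := by
    refine ge_of_tendsto hlim ?_
    filter_upwards [Ico_mem_nhdsLT (show t - T < t by linarith)] with s hs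
    exact hmono ⟨le_rfl, by linarith⟩ hs hs.1
  rw [show exp (12 * n * r * t) = exp (12 * n * r * (t - T)) * exp (12 * n * r * T) by
    rw [← exp_add]; ring_nf, mul_assoc (exp (12 * n * r * (t - T)))] at hle
  exact le_of_mul_le_mul_left hle (exp_pos _)

theorem tendsto_cutoff (q c : ℝ) :
    Tendsto (fun k : ℕ => max (1 - 1 / ((k : ℝ) + 1) * q) 0 ^ 3 * c) atTop (𝓝 c) := by
  have h1 : Continuous fun r : ℝ => max (1 - r * q) 0 ^ 3 * c := by fun_prop
  simpa [Function.comp_def] using (h1.tendsto 0).comp tendsto_one_div_add_atTop_nhds_zero_nat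

theorem integrable_heatKernel_mul_and_integral_le (hu : IsAncientHeat n u)
    (hnonneg : ∀ (x : EuclideanSpace ℝ (Fin n)) (t : ℝ), t ≤ 0 → 0 ≤ u (x, t)) {T t : ℝ}
    (hT : 0 < T) (ht : t ≤ 0) (x : EuclideanSpace ℝ (Fin n)) :
    Integrable (fun y => heatKernel n T (y - x) * u (y, t - T)) ∧
      ∫ y, heatKernel n T (y - x) * u (y, t - T) ≤ u (x, t) := by
  have huc := hu.1.continuous
  have hcK : Continuous fun y => heatKernel n T (y - x) :=
    (continuous_heatKernel T).comp (by fun_prop)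
  have h0 : ∀ y, 0 ≤ heatKernel n T (y - x) * u (y, t - T) := fun y =>
    mul_nonneg (heatKernel_nonneg hT.le _) (hnonneg _ _ (by linarith))
  have hle : ∫⁻ y, ENNReal.ofReal (heatKernel n T (y - x) * u (y, t - T)) ≤
      ENNReal.ofReal (u (x, t)) := by
    have hr : ∀ k : ℕ, 0 < 1 / ((k : ℝ) + 1) := fun k => by positivity
    have hbound : ∀ᶠ k : ℕ in atTop, ∫⁻ y, ENNReal.ofReal (heatKernel n T (y - x) *
        (max (1 - 1 / ((k : ℝ) + 1) * ‖y - x‖ ^ 2) 0 ^ 3 * u (y, t - T))) ≤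
        ENNReal.ofReal (exp (12 * n * (1 / ((k : ℝ) + 1)) * T) * u (x, t)) := by
      have h1 : Tendsto (fun k : ℕ => (n : ℝ) * (1 / ((k : ℝ) + 1)) * T) atTop (𝓝 0) := by
        simpa using (tendsto_one_div_add_atTop_nhds_zero_nat.const_mul (n : ℝ)).mul_const T
      filter_upwards [h1.eventually (ge_mem_nhds one_half_pos)] with k hk
      have h2 := truncatedHeatMean_le hu hnonneg (hr k) hT ht hk x
      rw [truncatedHeatMean, sub_sub_cancel] at h2
      rw [← ofReal_integral_eq_lintegral_ofReal]
      · exact ENNReal.ofReal_le_ofReal h2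
      · exact integrable_of_cutoff (hr k) x (by fun_prop) fun y hy => by rw [hy]; simp
      · exact Eventually.of_forall fun y => mul_nonneg (heatKernel_nonneg hT.le _)
          (mul_nonneg (by positivity) (hnonneg _ _ (by linarith)))
    have hlim : Tendsto (fun k : ℕ => ENNReal.ofReal (exp (12 * n * (1 / ((k : ℝ) + 1)) * T) *
        u (x, t))) atTop (𝓝 (ENNReal.ofReal (u (x, t)))) := by
      have h1 : Continuous fun r : ℝ => ENNReal.ofReal (exp (12 * n * r * T) * u (x, t)) :=
        ENNReal.continuous_ofReal.comp (by fun_prop)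
      simpa [Function.comp_def] using (h1.tendsto 0).comp tendsto_one_div_add_atTop_nhds_zero_nat
    calc _ = ∫⁻ y, liminf (fun k : ℕ => ENNReal.ofReal (heatKernel n T (y - x) *
        (max (1 - 1 / ((k : ℝ) + 1) * ‖y - x‖ ^ 2) 0 ^ 3 * u (y, t - T)))) atTop := by
          refine lintegral_congr fun y => (Tendsto.liminf_eq ?_).symm
          exact (ENNReal.continuous_ofReal.tendsto _).comp ((tendsto_cutoff _ _).const_mul _)
      _ ≤ liminf (fun k : ℕ => ∫⁻ y, ENNReal.ofReal (heatKernel n T (y - x) *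
        (max (1 - 1 / ((k : ℝ) + 1) * ‖y - x‖ ^ 2) 0 ^ 3 * u (y, t - T)))) atTop :=
          lintegral_liminf_le fun k =>
            (ENNReal.continuous_ofReal.comp (by fun_prop)).measurable
      _ ≤ liminf (fun k : ℕ => ENNReal.ofReal (exp (12 * n * (1 / ((k : ℝ) + 1)) * T) *
        u (x, t))) atTop := liminf_le_liminf hbound
      _ = _ := hlim.liminf_eq
  have hI : Integrable fun y => heatKernel n T (y - x) * u (y, t - T) := by
    refine ⟨Continuous.aestronglyMeasurable (by fun_prop), ?_⟩
    rw [hasFiniteIntegral_iff_ofReal (Eventually.of_forall h0)]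
    exact hle.trans_lt ENNReal.ofReal_lt_top
  refine ⟨hI, ?_⟩
  rwa [← ofReal_integral_eq_lintegral_ofReal hI (Eventually.of_forall h0),
    ENNReal.ofReal_le_ofReal_iff (hnonneg x t ht)] at hle

end MeanValue

section Representation

variable {n : ℕ} {u : EuclideanSpace ℝ (Fin n) × ℝ → ℝ}

theorem exists_heatKernel_mul_le (n : ℕ) {θ A : ℝ} (hθ : 0 < θ) (hA : 0 ≤ A) :
    ∃ C, 0 ≤ C ∧ ∀ τ > 0, ∀ z : EuclideanSpace ℝ (Fin n),
      heatKernel n τ z * (A + 6 * ‖z‖ ^ 2 / τ) ≤ C * heatKernel n ((1 + θ) * τ) z := by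
  set c := θ / (4 * (1 + θ)) with hc
  have hc0 : 0 < c := by positivity
  refine ⟨(1 + θ) ^ ((n : ℝ) / 2) * (A + 6 / c), by positivity, fun τ hτ z => ?_⟩
  have h1 : A + 6 * ‖z‖ ^ 2 / τ ≤ (A + 6 / c) * exp (c * (‖z‖ ^ 2 / τ)) := by
    have hz : 0 ≤ c * (‖z‖ ^ 2 / τ) := by positivity
    have h2 := add_one_le_exp (c * (‖z‖ ^ 2 / τ))
    have h3 : A ≤ A * exp (c * (‖z‖ ^ 2 / τ)) := le_mul_of_one_le_right hA (by linarith)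
    have h4 : 6 * ‖z‖ ^ 2 / τ = 6 / c * (c * (‖z‖ ^ 2 / τ)) := by field_simp
    have h5 : 6 / c * (c * (‖z‖ ^ 2 / τ)) ≤ 6 / c * exp (c * (‖z‖ ^ 2 / τ)) := by
      gcongr
      linarith
    linarith
  have h2 : heatKernel n τ z * exp (c * (‖z‖ ^ 2 / τ)) =
      (1 + θ) ^ ((n : ℝ) / 2) * heatKernel n ((1 + θ) * τ) z := by
    have h3 : (1 + θ) ^ ((n : ℝ) / 2) * (4 * π * ((1 + θ) * τ)) ^ (-(n : ℝ) / 2) =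
        (4 * π * τ) ^ (-(n : ℝ) / 2) := by
      rw [show 4 * π * ((1 + θ) * τ) = (1 + θ) * (4 * π * τ) by ring,
        mul_rpow (by positivity) (by positivity), ← mul_assoc, ← rpow_add (by positivity),
        show (n : ℝ) / 2 + -n / 2 = 0 by ring, rpow_zero, one_mul]
    rw [heatKernel, heatKernel, ← mul_assoc, h3, mul_assoc, ← exp_add]
    congr 2
    rw [hc]
    field_simp
    ring
  calc _ ≤ heatKernel n τ z * ((A + 6 / c) * exp (c * (‖z‖ ^ 2 / τ))) :=
        mul_le_mul_of_nonneg_left h1 (heatKernel_nonneg hτ.le z)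
    _ = (A + 6 / c) * (heatKernel n τ z * exp (c * (‖z‖ ^ 2 / τ))) := by ring
    _ = _ := by rw [h2]; ring

theorem abs_cutoff_coefficient_le {r q τ N : ℝ} (hr : 0 < r) (hq : 0 ≤ q) (hτ : 0 < τ)
    (hN : 0 ≤ N) :
    |-(6 * N * r) * max (1 - r * q) 0 ^ 2 + 6 * r * q / τ * max (1 - r * q) 0 ^ 2 +
      24 * r ^ 2 * q * max (1 - r * q) 0| ≤ r * ((6 * N + 24) + 6 * q / τ) := by
  have hw : 0 ≤ max (1 - r * q) 0 := le_max_right _ _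
  have hrq : 0 ≤ r * q := by positivity
  have hw1 : max (1 - r * q) 0 ≤ 1 := max_le (by linarith) zero_le_one
  have hrw : r * q * max (1 - r * q) 0 ≤ 1 := by
    rcases le_total (r * q) 1 with h | h
    · exact mul_le_one₀ h hw hw1
    · rw [max_eq_right (by linarith), mul_zero]
      exact zero_le_one
  set w := max (1 - r * q) 0
  have hw2 : w ^ 2 ≤ 1 := pow_le_one₀ hw hw1
  have hw20 : 0 ≤ w ^ 2 := by positivity
  have h1 : 6 * N * r * w ^ 2 ≤ 6 * N * r := mul_le_of_le_one_right (by positivity) hw2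
  have h10 : 0 ≤ 6 * N * r * w ^ 2 := by positivity
  have h2 : 6 * r * q / τ * w ^ 2 ≤ 6 * r * q / τ := mul_le_of_le_one_right (by positivity) hw2
  have h20 : 0 ≤ 6 * r * q / τ * w ^ 2 := by positivity
  have h3 : 24 * r ^ 2 * q * w ≤ 24 * r := by nlinarith
  have h30 : 0 ≤ 24 * r ^ 2 * q * w := by positivity
  have h4 : r * ((6 * N + 24) + 6 * q / τ) = 6 * N * r + 24 * r + 6 * r * q / τ := by ring
  rw [h4, abs_le]
  constructor <;> linarith

theorem abs_sub_truncatedHeatMean_le (hu : IsAncientHeat n u)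
    (hnonneg : ∀ (x : EuclideanSpace ℝ (Fin n)) (t : ℝ), t ≤ 0 → 0 ≤ u (x, t)) {T t : ℝ}
    (hT : 0 < T) (ht : t < 0) (x : EuclideanSpace ℝ (Fin n)) :
    ∃ C, ∀ r > 0, |u (x, t) - truncatedHeatMean u r x t (t - T)| ≤ r * C := by
  have huc := hu.1.continuous
  obtain ⟨θ, hθ0, hθ⟩ : ∃ θ > 0, θ * T = -t :=
    ⟨-t / T, div_pos (neg_pos.2 ht) hT, div_mul_cancel₀ _ hT.ne'⟩
  obtain ⟨M, hM⟩ := (isCompact_Icc (a := t) (b := 0)).exists_bound_of_continuousOn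
    (f := fun s => u (x, s)) (Continuous.continuousOn (by fun_prop))
  obtain ⟨C, hC0, hC⟩ := exists_heatKernel_mul_le n hθ0
    (A := 6 * n + 24) (by positivity)
  refine ⟨C * M * T, fun r hr => ?_⟩
  have hd := fun s (hs : s < t) => hasDerivAt_integral_heatKernel_mul_cutoff hu hr x hs ht.le
  have hbound : ∀ s ∈ Ico (t - T) t, ‖∫ y, heatKernel n (t - s) (y - x) *
      ((-(6 * n * r) * max (1 - r * ‖y - x‖ ^ 2) 0 ^ 2 +
        6 * r * ‖y - x‖ ^ 2 / (t - s) * max (1 - r * ‖y - x‖ ^ 2) 0 ^ 2 +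
        24 * r ^ 2 * ‖y - x‖ ^ 2 * max (1 - r * ‖y - x‖ ^ 2) 0) * u (y, s))‖ ≤ r * (C * M) := by
    intro s hs
    have hτ : 0 < t - s := sub_pos.2 hs.2
    have hτT : t - s ≤ T := by linarith [hs.1]
    have hle : t + θ * (t - s) ≤ 0 := by nlinarith
    obtain ⟨hI, hint⟩ := integrable_heatKernel_mul_and_integral_le hu hnonneg
      (T := (1 + θ) * (t - s)) (by positivity) hle x
    rw [show t + θ * (t - s) - (1 + θ) * (t - s) = s by ring] at hI hint
    have hMb := (le_abs_self _).trans (hM (t + θ * (t - s)) ⟨by nlinarith, hle⟩)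
    refine (norm_integral_le_of_norm_le (hI.const_mul (r * C))
      (Eventually.of_forall fun y => ?_)).trans ?_
    · have hus := hnonneg y s (hs.2.le.trans ht.le)
      have hK := heatKernel_nonneg hτ.le (y - x)
      rw [norm_mul, norm_mul, Real.norm_of_nonneg hK, Real.norm_of_nonneg hus, Real.norm_eq_abs]
      calc _ ≤ heatKernel n (t - s) (y - x) *
            (r * ((6 * n + 24) + 6 * ‖y - x‖ ^ 2 / (t - s)) * u (y, s)) := by
              gcongr
              exact abs_cutoff_coefficient_le hr (by positivity) hτ (by positivity)
        _ = r * (heatKernel n (t - s) (y - x) * ((6 * n + 24) + 6 * ‖y - x‖ ^ 2 / (t - s))) *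
            u (y, s) := by ring
        _ ≤ r * (C * heatKernel n ((1 + θ) * (t - s)) (y - x)) * u (y, s) := by
              exact mul_le_mul_of_nonneg_right (mul_le_mul_of_nonneg_left (hC _ hτ _) hr.le) hus
        _ = _ := by ring
    · rw [integral_const_mul, mul_assoc]
      gcongr
      exact hint.trans hMb
  have hmv : ∀ s ∈ Ico (t - T) t, |truncatedHeatMean u r x t s -
      truncatedHeatMean u r x t (t - T)| ≤ r * (C * M * T) := by
    intro s hs
    have := (convex_Ico (t - T) t).norm_image_sub_le_of_norm_hasDerivWithin_le
      (fun s hs => (hd s hs.2).hasDerivWithinAt) hbound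
      (show t - T ∈ Ico (t - T) t from ⟨le_rfl, by linarith⟩) hs
    refine this.trans ?_
    rw [Real.norm_of_nonneg (by linarith [hs.1]), mul_assoc]
    have hM0 : 0 ≤ M := (norm_nonneg _).trans (hM t ⟨le_rfl, ht.le⟩)
    gcongr
    linarith [hs.2]
  refine le_of_tendsto ((tendsto_truncatedHeatMean hu hr x t).sub_const _).abs ?_
  filter_upwards [Ico_mem_nhdsLT (show t - T < t by linarith)] with s hs using hmv s hs

theorem integral_heatKernel_mul_eq (hu : IsAncientHeat n u)
    (hnonneg : ∀ (x : EuclideanSpace ℝ (Fin n)) (t : ℝ), t ≤ 0 → 0 ≤ u (x, t)) {T t : ℝ}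
    (hT : 0 < T) (ht : t < 0) (x : EuclideanSpace ℝ (Fin n)) :
    ∫ y, heatKernel n T (y - x) * u (y, t - T) = u (x, t) := by
  have huc := hu.1.continuous
  have hcK : Continuous fun y => heatKernel n T (y - x) :=
    (continuous_heatKernel T).comp (by fun_prop)
  obtain ⟨C, hC⟩ := abs_sub_truncatedHeatMean_le hu hnonneg hT ht x
  have hlim : Tendsto (fun k : ℕ => truncatedHeatMean u (1 / ((k : ℝ) + 1)) x t (t - T)) atTop
      (𝓝 (∫ y, heatKernel n T (y - x) * u (y, t - T))) := by
    unfold truncatedHeatMean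
    simp only [sub_sub_cancel]
    refine tendsto_integral_of_dominated_convergence _ (fun k =>
      Continuous.aestronglyMeasurable (by fun_prop))
      (integrable_heatKernel_mul_and_integral_le hu hnonneg hT ht.le x).1
      (fun k => Eventually.of_forall fun y => ?_)
      (Eventually.of_forall fun y => (tendsto_cutoff _ _).const_mul _)
    have h0 := hnonneg y (t - T) (by linarith)
    rw [norm_mul, norm_mul, Real.norm_of_nonneg (heatKernel_nonneg hT.le _),
      Real.norm_of_nonneg h0, Real.norm_of_nonneg (by positivity)]
    refine mul_le_mul_of_nonneg_left (mul_le_of_le_one_left h0 (pow_le_one₀ (le_max_right _ _)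
      (max_le ?_ zero_le_one))) (heatKernel_nonneg hT.le _)
    have : 0 ≤ 1 / ((k : ℝ) + 1) * ‖y - x‖ ^ 2 := by positivity
    linarith
  have h2 : Tendsto (fun k : ℕ => u (x, t) - truncatedHeatMean u (1 / ((k : ℝ) + 1)) x t (t - T))
      atTop (𝓝 0) := by
    refine squeeze_zero_norm (fun k => hC _ (by positivity)) ?_
    simpa using tendsto_one_div_add_atTop_nhds_zero_nat.mul_const C
  exact (tendsto_nhds_unique (hlim.const_sub _) h2 |> sub_eq_zero.1).symm

end Representation

section RepresentingMeasure

variable {n : ℕ} {u : EuclideanSpace ℝ (Fin n) × ℝ → ℝ}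

theorem abs_exp_mul_sub_exp_le {a p B : ℝ} (ha : 1 ≤ a) (hB : 0 ≤ B) (hp : p ≤ B) :
    |exp (a * p) - exp p| ≤ (a - 1) * (1 + B * exp (a * B)) := by
  have hBe : 0 ≤ B * exp (a * B) := by positivity
  have ha' : 0 ≤ a - 1 := by linarith
  rcases le_total p 0 with h | h
  · have h1 : exp (a * p) = exp p * exp ((a - 1) * p) := by rw [← exp_add]; ring_nf
    have h2 := add_one_le_exp ((a - 1) * p)
    have h3 : -p * exp p ≤ 1 := by
      have := add_one_le_exp (-p)
      calc -p * exp p ≤ exp (-p) * exp p := by gcongr; linarith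
        _ = 1 := by rw [← exp_add]; simp
    have h4 : exp (a * p) ≤ exp p := exp_le_exp.2 (by nlinarith)
    have h5 : exp p * (1 - exp ((a - 1) * p)) ≤ exp p * (-((a - 1) * p)) := by
      gcongr
      linarith
    rw [abs_of_nonpos (by linarith)]
    nlinarith
  · have h1 : exp p = exp (a * p) * exp (-((a - 1) * p)) := by rw [← exp_add]; ring_nf
    have h2 := add_one_le_exp (-((a - 1) * p))
    have h4 : exp p ≤ exp (a * p) := exp_le_exp.2 (by nlinarith)
    have h5 : exp (a * p) * (1 - exp (-((a - 1) * p))) ≤ exp (a * p) * ((a - 1) * p) := by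
      gcongr
      linarith
    have h6 : exp (a * p) * ((a - 1) * p) ≤ exp (a * B) * ((a - 1) * B) := by gcongr
    rw [abs_of_nonneg (by linarith)]
    nlinarith

theorem inner_add_mul_norm_sq_le {t : ℝ} (ht : t < 0) (x ξ : EuclideanSpace ℝ (Fin n)) :
    inner ℝ x ξ + t * ‖ξ‖ ^ 2 ≤ ‖x‖ ^ 2 / (4 * -t) := by
  rw [le_div_iff₀ (by linarith)]
  nlinarith [real_inner_le_norm x ξ, sq_nonneg (‖x‖ - 2 * -t * ‖ξ‖)]

theorem tendsto_exp_inner_cocompact {t : ℝ} (ht : t < 0) (x : EuclideanSpace ℝ (Fin n)) :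
    Tendsto (fun ξ => exp (inner ℝ x ξ + t * ‖ξ‖ ^ 2)) (cocompact _) (𝓝 0) := by
  refine tendsto_exp_atBot.comp ?_
  have h1 : Tendsto (fun r : ℝ => r * (‖x‖ + t * r)) atTop atBot :=
    tendsto_id.atTop_mul_atBot₀ (tendsto_atBot_add_const_left _ _
      (tendsto_id.const_mul_atTop_of_neg ht))
  refine tendsto_atBot_mono (fun ξ => ?_)
    (h1.comp (tendsto_norm_cocompact_atTop (E := EuclideanSpace ℝ (Fin n))))
  have := real_inner_le_norm x ξ
  simp only [Function.comp]
  nlinarith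

theorem tendstoUniformly_mul_exp_inner {t : ℝ} (ht : t < 0) (x : EuclideanSpace ℝ (Fin n))
    {a c : ℕ → ℝ} (ha : Tendsto a atTop (𝓝 1)) (ha1 : ∀ᶠ k in atTop, 1 ≤ a k)
    (hc : Tendsto c atTop (𝓝 1)) :
    TendstoUniformly (fun k ξ => c k * exp (a k * (inner ℝ x ξ + t * ‖ξ‖ ^ 2)))
      (fun ξ => exp (inner ℝ x ξ + t * ‖ξ‖ ^ 2)) atTop := by
  set B := ‖x‖ ^ 2 / (4 * -t)
  have hB : 0 ≤ B := div_nonneg (by positivity) (by linarith)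
  have hlim : Tendsto (fun k => |c k - 1| * exp (a k * B) +
      (a k - 1) * (1 + B * exp (a k * B))) atTop (𝓝 0) := by
    have he : Tendsto (fun k => exp (a k * B)) atTop (𝓝 (exp (1 * B))) :=
      (continuous_exp.tendsto _).comp (ha.mul_const B)
    simpa using ((hc.sub_const 1).abs.mul he).add
      ((ha.sub_const 1).mul ((he.const_mul B).const_add 1))
  rw [Metric.tendstoUniformly_iff]
  intro ε hε
  filter_upwards [hlim.eventually (gt_mem_nhds hε), ha1] with k hk hk1 ξ
  have hp := inner_add_mul_norm_sq_le ht x ξ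
  set p := inner ℝ x ξ + t * ‖ξ‖ ^ 2
  rw [dist_comm, Real.dist_eq]
  refine lt_of_le_of_lt ?_ hk
  calc |c k * exp (a k * p) - exp p| = |(c k - 1) * exp (a k * p) + (exp (a k * p) - exp p)| := by
        ring_nf
    _ ≤ |c k - 1| * exp (a k * p) + |exp (a k * p) - exp p| := by
        refine (abs_add_le _ _).trans_eq ?_
        rw [abs_mul, abs_of_pos (exp_pos _)]
    _ ≤ _ := by
        gcongr
        exact abs_exp_mul_sub_exp_le hk1 hB hp

theorem heatKernel_add_sub_eq {T t : ℝ} (hT : 0 < T) (hTt : 0 < T + t)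
    (x y : EuclideanSpace ℝ (Fin n)) :
    heatKernel n (T + t) (y - x) = heatKernel n T y *
      ((T / (T + t)) ^ ((n : ℝ) / 2) * exp (-(T / (T + t)) * ‖x‖ ^ 2 / (4 * T)) *
        exp (T / (T + t) * (inner ℝ x ((2 * T)⁻¹ • y) + t * ‖(2 * T)⁻¹ • y‖ ^ 2))) := by
  have h1 : (4 * π * (T + t)) ^ (-(n : ℝ) / 2) =
      (4 * π * T) ^ (-(n : ℝ) / 2) * (T / (T + t)) ^ ((n : ℝ) / 2) := by
    rw [neg_div, rpow_neg (by positivity), rpow_neg (by positivity), ← inv_rpow (by positivity),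
      ← inv_rpow (by positivity), ← mul_rpow (by positivity) (by positivity)]
    congr 1
    field_simp
  have h2 : -‖y - x‖ ^ 2 / (4 * (T + t)) = -‖y‖ ^ 2 / (4 * T) +
      (-(T / (T + t)) * ‖x‖ ^ 2 / (4 * T) +
        T / (T + t) * (inner ℝ x ((2 * T)⁻¹ • y) + t * ‖(2 * T)⁻¹ • y‖ ^ 2)) := by
    rw [norm_smul, mul_pow, inner_smul_right, norm_sub_sq_real, Real.norm_of_nonneg (by positivity),
      real_inner_comm]
    field_simp
    ring
  rw [heatKernel, heatKernel, h1, h2, exp_add, exp_add]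
  ring

/-- The measure `heatKernel n T y * u (y, -T) dy`, rescaled by `(2 * T)⁻¹`. -/
def rescaledHeatMeasure (u : EuclideanSpace ℝ (Fin n) × ℝ → ℝ) (T : ℝ) :
    Measure (EuclideanSpace ℝ (Fin n)) :=
  (volume.withDensity fun y => ENNReal.ofReal (heatKernel n T y * u (y, -T))).map
    fun y => (2 * T)⁻¹ • y

theorem integral_rescaledHeatMeasure (hu : Continuous u) {T : ℝ} (hT : 0 < T)
    (h0 : ∀ y, 0 ≤ u (y, -T)) (G : EuclideanSpace ℝ (Fin n) → ℝ) :
    ∫ ξ, G ξ ∂(rescaledHeatMeasure u T) =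
      ∫ y, heatKernel n T y * u (y, -T) * G ((2 * T)⁻¹ • y) := by
  have hcK := continuous_heatKernel (n := n) T
  rw [rescaledHeatMeasure, (measurableEmbedding_const_smul₀ (by positivity)).integral_map,
    integral_withDensity_eq_integral_toReal_smul
      (f := fun y => ENNReal.ofReal (heatKernel n T y * u (y, -T)))
      (ENNReal.continuous_ofReal.comp (by fun_prop)).measurable
      (Eventually.of_forall fun _ => ENNReal.ofReal_lt_top)]
  refine integral_congr_ae (Eventually.of_forall fun y => ?_)
  simp only [smul_eq_mul]
  rw [ENNReal.toReal_ofReal (mul_nonneg (heatKernel_nonneg hT.le y) (h0 y))]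

theorem integrable_rescaledHeatMeasure_iff (hu : Continuous u) {T : ℝ} (hT : 0 < T)
    (h0 : ∀ y, 0 ≤ u (y, -T)) (G : EuclideanSpace ℝ (Fin n) → ℝ) :
    Integrable G (rescaledHeatMeasure u T) ↔
      Integrable fun y => heatKernel n T y * u (y, -T) * G ((2 * T)⁻¹ • y) := by
  have hcK := continuous_heatKernel (n := n) T
  rw [rescaledHeatMeasure, (measurableEmbedding_const_smul₀ (by positivity)).integrable_map_iff,
    integrable_withDensity_iff_integrable_smul'
      (f := fun y => ENNReal.ofReal (heatKernel n T y * u (y, -T)))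
      (ENNReal.continuous_ofReal.comp (by fun_prop)).measurable
      (Eventually.of_forall fun _ => ENNReal.ofReal_lt_top)]
  refine integrable_congr (Eventually.of_forall fun y => ?_)
  simp only [smul_eq_mul, Function.comp]
  rw [ENNReal.toReal_ofReal (mul_nonneg (heatKernel_nonneg hT.le y) (h0 y))]

theorem exists_measure_lintegral_exp_inner_of_neg (hu : IsAncientHeat n u)
    (hnonneg : ∀ (x : EuclideanSpace ℝ (Fin n)) (t : ℝ), t ≤ 0 → 0 ≤ u (x, t)) :
    ∃ μ : Measure (EuclideanSpace ℝ (Fin n)), ∀ x t, t < 0 →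
      ∫⁻ ξ, ENNReal.ofReal (exp (inner ℝ x ξ + t * ‖ξ‖ ^ 2)) ∂μ = ENNReal.ofReal (u (x, t)) := by
  have huc := hu.1.continuous
  have hT : ∀ k : ℕ, (0 : ℝ) < k + 1 := fun k => by positivity
  have h0 : ∀ (k : ℕ) y, 0 ≤ u (y, -((k : ℝ) + 1)) := fun k y => hnonneg _ _ (by linarith [hT k])
  have hfin : ∀ k : ℕ, IsFiniteMeasure (rescaledHeatMeasure u ((k : ℝ) + 1)) := by
    intro k
    have h := (integrable_heatKernel_mul_and_integral_le hu hnonneg (hT k) le_rfl 0).1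
    simp only [sub_zero, zero_sub] at h
    rw [← integrable_const_iff_isFiniteMeasure (c := (1 : ℝ)) one_ne_zero,
      integrable_rescaledHeatMeasure_iff huc (hT k) (h0 k)]
    simpa using h
  have hmass : ∀ k : ℕ, (rescaledHeatMeasure u ((k : ℝ) + 1)).real univ ≤ u (0, 0) := by
    intro k
    have h := (integrable_heatKernel_mul_and_integral_le hu hnonneg (hT k) le_rfl 0).2
    have h2 := integral_rescaledHeatMeasure huc (hT k) (h0 k) fun _ => 1
    simp only [sub_zero, zero_sub] at h
    simp only [integral_const, smul_eq_mul, mul_one] at h2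
    rwa [h2]
  obtain ⟨μ, hμ⟩ := exists_measure_lintegral_eq_of_uniform_limit hmass
  refine ⟨μ, fun x t ht => ?_⟩
  set a : ℕ → ℝ := fun k => ((k : ℝ) + 1) / ((k : ℝ) + 1 + t) with ha
  have hk : ∀ᶠ k : ℕ in atTop, 0 < (k : ℝ) + 1 + t :=
    (tendsto_natCast_atTop_atTop.eventually_gt_atTop (-t)).mono fun k hk => by linarith
  have hT_top : Tendsto (fun k : ℕ => (k : ℝ) + 1) atTop atTop :=
    tendsto_atTop_add_const_right _ _ tendsto_natCast_atTop_atTop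
  have ha_lim : Tendsto a atTop (𝓝 1) := by
    have h1 : Tendsto (fun k : ℕ => 1 / (1 + t / ((k : ℝ) + 1))) atTop (𝓝 (1 / (1 + 0))) :=
      tendsto_const_nhds.div ((hT_top.const_div_atTop t).const_add 1) (by simp)
    simp only [add_zero, div_one] at h1
    refine h1.congr' ?_
    filter_upwards [hk] with k hk
    have := hT k
    rw [ha]
    field_simp
  have hc_lim : Tendsto (fun k => a k ^ ((n : ℝ) / 2) *
      exp (-(a k) * ‖x‖ ^ 2 / (4 * ((k : ℝ) + 1)))) atTop (𝓝 1) := by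
    have h1 : Tendsto (fun k => a k ^ ((n : ℝ) / 2)) atTop (𝓝 (1 ^ ((n : ℝ) / 2))) :=
      ha_lim.rpow_const (Or.inl one_ne_zero)
    have h2 : Tendsto (fun k => exp (-(a k) * ‖x‖ ^ 2 / (4 * ((k : ℝ) + 1)))) atTop
        (𝓝 (exp 0)) := (continuous_exp.tendsto 0).comp
      ((ha_lim.neg.mul_const _).div_atTop (hT_top.const_mul_atTop (by norm_num)))
    simpa using h1.mul h2
  have hkey : ∀ k : ℕ, 0 < (k : ℝ) + 1 + t → ∀ y : EuclideanSpace ℝ (Fin n),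
      heatKernel n (k + 1) y * u (y, -((k : ℝ) + 1)) *
        (a k ^ ((n : ℝ) / 2) * exp (-(a k) * ‖x‖ ^ 2 / (4 * ((k : ℝ) + 1))) *
        exp (a k * (inner ℝ x ((2 * ((k : ℝ) + 1))⁻¹ • y) +
          t * ‖(2 * ((k : ℝ) + 1))⁻¹ • y‖ ^ 2))) =
      heatKernel n (k + 1 + t) (y - x) * u (y, t - (k + 1 + t)) := by
    intro k hk y
    rw [heatKernel_add_sub_eq (hT k) hk, show t - ((k : ℝ) + 1 + t) = -(k + 1) by ring]
    ring
  refine hμ _ (fun k ξ => a k ^ ((n : ℝ) / 2) * exp (-(a k) * ‖x‖ ^ 2 / (4 * ((k : ℝ) + 1))) *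
    exp (a k * (inner ℝ x ξ + t * ‖ξ‖ ^ 2))) _ (by fun_prop) (fun ξ => (exp_pos _).le)
    (tendsto_exp_inner_cocompact ht x) ?_
    (tendstoUniformly_mul_exp_inner ht x ha_lim ?_ hc_lim) ?_
  · filter_upwards [hk] with k hk
    rw [integrable_rescaledHeatMeasure_iff huc (hT k) (h0 k)]
    simp only [hkey k hk]
    exact (integrable_heatKernel_mul_and_integral_le hu hnonneg hk ht.le x).1
  · filter_upwards [hk] with k hk
    rw [ha, le_div_iff₀ hk]
    linarith
  · filter_upwards [hk] with k hk
    rw [integral_rescaledHeatMeasure huc (hT k) (h0 k)]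
    simp only [hkey k hk]
    exact integral_heatKernel_mul_eq hu hnonneg hk ht x

theorem exists_measure_lintegral_exp_inner (hu : IsAncientHeat n u)
    (hnonneg : ∀ (x : EuclideanSpace ℝ (Fin n)) (t : ℝ), t ≤ 0 → 0 ≤ u (x, t)) :
    ∃ μ : Measure (EuclideanSpace ℝ (Fin n)), ∀ x t, t ≤ 0 →
      ∫⁻ ξ, ENNReal.ofReal (exp (inner ℝ x ξ + t * ‖ξ‖ ^ 2)) ∂μ = ENNReal.ofReal (u (x, t)) := by
  obtain ⟨μ, hμ⟩ := exists_measure_lintegral_exp_inner_of_neg hu hnonneg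
  refine ⟨μ, fun x t ht => ?_⟩
  rcases ht.lt_or_eq with ht | rfl
  · exact hμ x t ht
  have huc := hu.1.continuous
  have hlim : ∀ {f : ℝ → ENNReal}, Continuous f →
      Tendsto (fun k : ℕ => f (-(1 / ((k : ℝ) + 1)))) atTop (𝓝 (f 0)) := by
    intro f hf
    have := tendsto_one_div_add_atTop_nhds_zero_nat (𝕜 := ℝ).neg
    rw [neg_zero] at this
    exact (hf.tendsto 0).comp this
  have h1 := lintegral_tendsto_of_tendsto_of_monotone (μ := μ)
    (f := fun (k : ℕ) ξ => ENNReal.ofReal (exp (inner ℝ x ξ + -(1 / ((k : ℝ) + 1)) * ‖ξ‖ ^ 2)))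
    (F := fun ξ => ENNReal.ofReal (exp (inner ℝ x ξ + 0 * ‖ξ‖ ^ 2)))
    (fun k => (ENNReal.continuous_ofReal.comp (by fun_prop)).aemeasurable)
    (Eventually.of_forall fun ξ => fun k l hkl => by
      dsimp only
      gcongr)
    (Eventually.of_forall fun ξ => hlim (f := fun t => ENNReal.ofReal
      (exp (inner ℝ x ξ + t * ‖ξ‖ ^ 2))) (ENNReal.continuous_ofReal.comp (by fun_prop)))
  refine tendsto_nhds_unique h1 ((hlim (f := fun t => ENNReal.ofReal (u (x, t)))
    (ENNReal.continuous_ofReal.comp (by fun_prop))).congr fun k => ?_)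
  rw [hμ x _ (by simp; positivity)]

end RepresentingMeasure

end HeatRepresentation

/-- every nonnegative ancient solution of the heat equation on
`ℝⁿ × (-∞, 0]` is the Laplace transform, with respect to a nonnegative Borel measure
`ρ` on `[0,∞)`, of a jointly measurable family `h(s,·) ≥ 0` of solutions of the
elliptic equations `Δ h(s,·) = s h(s,·)`:
`u(x,t) = ∫₀^∞ e^{ts} h(s,x) dρ(s)` for `t ≤ 0`. -/
theorem ancient_nonneg_heat_elliptic_laplace_rep (n : ℕ)
    (u : EuclideanSpace ℝ (Fin n) × ℝ → ℝ)
    (hu : IsAncientHeat n u)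
    (hnonneg : ∀ (x : EuclideanSpace ℝ (Fin n)) (t : ℝ), t ≤ 0 → 0 ≤ u (x, t)) :
    ∃ (ρ : Measure ℝ) (h : ℝ → EuclideanSpace ℝ (Fin n) → ℝ),
      ρ (Set.Iio 0) = 0 ∧
      (∀ (s : ℝ) (x : EuclideanSpace ℝ (Fin n)), 0 ≤ h s x) ∧
      Measurable (Function.uncurry h) ∧
      (∀ᵐ s ∂ρ, ContDiff ℝ (⊤ : ℕ∞) (h s) ∧
        ∀ x : EuclideanSpace ℝ (Fin n), lap n (h s) x = s * h s x) ∧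
      ∀ (x : EuclideanSpace ℝ (Fin n)) (t : ℝ), t ≤ 0 →
        u (x, t) = ∫ s, Real.exp (t * s) * h s x ∂ρ := by
  obtain ⟨μ, hμ⟩ := exists_measure_lintegral_exp_inner hu hnonneg
  have : IsFiniteMeasure μ := ⟨by
    have h := hμ 0 0 le_rfl
    simp only [inner_zero_left, zero_mul, add_zero, exp_zero, ENNReal.ofReal_one,
      lintegral_one] at h
    exact h ▸ ENNReal.ofReal_lt_top⟩
  obtain ⟨ρ, h, hρ, h0, hm, hell, hrep⟩ := exists_elliptic_laplace_rep μ
  refine ⟨ρ, h, hρ, h0, hm, Filter.Eventually.of_forall hell, fun x t ht => ?_⟩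
  have hpos : 0 ≤ᵐ[μ] fun ξ => exp (inner ℝ x ξ + t * ‖ξ‖ ^ 2) :=
    Filter.Eventually.of_forall fun ξ => (exp_pos _).le
  have hI : Integrable (fun ξ => exp (inner ℝ x ξ + t * ‖ξ‖ ^ 2)) μ := by
    refine ⟨Continuous.aestronglyMeasurable (by fun_prop), ?_⟩
    rw [hasFiniteIntegral_iff_ofReal hpos, hμ x t ht]
    exact ENNReal.ofReal_lt_top
  rw [← hrep x t hI, integral_eq_lintegral_of_nonneg_ae hpos hI.aestronglyMeasurable,
    hμ x t ht, ENNReal.toReal_ofReal (hnonneg x t ht)]
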